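/- arXiv:1010.3484 — 3 statements merged into one kernel-verified Lean document; each statement's English description precedes it below -/
import Mathlib

section
/- There exists a constant C > 0 such that for every integer N ≥ 1 there is a probability distribution (G, H_N) on ℝ² with the following properties: the first marginal G has the standard N(0,1) Gaussian distribution; the second marginal H_N has the distribution of Σ_{i=1}^N b_i, where the b_i are i.i.d. uniform on {−1,1}; and Pr[|G − H_N/√N| ≤ C·N^{−1/4}] ≥ 1 − C·N^{−1/4}. -/
open MeasureTheory ProbabilityTheory Real
open scoped ENNReal NNReal

/-- Uniform measure on the signs `{-1, 1} ⊆ ℝ`. -/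
noncomputable def signUnif : Measure ℝ :=
  (2 : ℝ≥0∞)⁻¹ • Measure.dirac 1 + (2 : ℝ≥0∞)⁻¹ • Measure.dirac (-1)

/-- The distribution of a sum of `N` i.i.d. uniform `{-1, 1}` signs. -/
noncomputable def sumSigns (N : ℕ) : Measure ℝ :=
  (Measure.pi fun _ : Fin N => signUnif).map fun b => ∑ i, b i


noncomputable def ind (t x : ℝ) : ℝ := if x ≤ t then 1 else 0

lemma ind_eq (t : ℝ) : ind t = (Set.Iic t).indicator (fun _ => 1) := by
  funext x; simp [ind, Set.indicator]

lemma measurable_ind : Measurable (fun p : ℝ × ℝ => ind p.1 p.2) :=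
  Measurable.ite (measurableSet_le measurable_snd measurable_fst) measurable_const measurable_const

lemma measurable_ind_left (x : ℝ) : Measurable (fun t : ℝ => ind t x) :=
  measurable_ind.comp (measurable_id.prodMk measurable_const)

lemma measurable_ind_right (t : ℝ) : Measurable (fun x : ℝ => ind t x) :=
  measurable_ind.comp (measurable_const.prodMk measurable_id)

lemma abs_ind_le (t x : ℝ) : |ind t x| ≤ 1 := by
  unfold ind; split_ifs <;> simp

lemma integral_ind (μ : Measure ℝ) (t : ℝ) : ∫ x, ind t x ∂μ = μ.real (Set.Iic t) := by
  rw [ind_eq, integral_indicator measurableSet_Iic]; simp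

lemma integrable_ind (μ : Measure ℝ) [IsFiniteMeasure μ] (t : ℝ) : Integrable (ind t) μ := by
  refine Integrable.of_bound (measurable_ind_right t).aestronglyMeasurable 1 ?_
  filter_upwards with x using abs_ind_le t x

lemma lint_ind_left (x y : ℝ) : ∫⁻ t, ‖ind t x - ind t y‖ₑ = ‖x - y‖ₑ := by
  wlog h : y ≤ x generalizing x y
  · have := this y x (le_of_not_ge h)
    rw [enorm_sub_rev, ← this]; congr 1; funext t; rw [enorm_sub_rev]
  have : (fun t => ‖ind t x - ind t y‖ₑ) = (Set.Ico y x).indicator (fun _ => 1) := by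
    funext t
    simp only [ind, Set.indicator, Set.mem_Ico]
    split_ifs <;> simp <;> grind
  rw [this, lintegral_indicator measurableSet_Ico]
  simp [Real.enorm_eq_ofReal_abs, abs_of_nonneg (sub_nonneg.2 h)]

lemma lint_ind_right (x y : ℝ) : ∫⁻ t, ‖ind x t - ind y t‖ₑ = ‖x - y‖ₑ := by
  wlog h : y ≤ x generalizing x y
  · have := this y x (le_of_not_ge h)
    rw [enorm_sub_rev, ← this]; congr 1; funext t; rw [enorm_sub_rev]
  have : (fun t => ‖ind x t - ind y t‖ₑ) = (Set.Ioc y x).indicator (fun _ => 1) := by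
    funext t
    simp only [ind, Set.indicator, Set.mem_Ioc]
    split_ifs <;> simp <;> grind
  rw [this, lintegral_indicator measurableSet_Ioc]
  simp [Real.enorm_eq_ofReal_abs, abs_of_nonneg (sub_nonneg.2 h)]

/-- `L¹` distance of distribution functions. -/
noncomputable def W (μ ν : Measure ℝ) : ℝ≥0∞ :=
  ∫⁻ t, ‖μ.real (Set.Iic t) - ν.real (Set.Iic t)‖ₑ

lemma measurable_Iic (μ : Measure ℝ) [IsFiniteMeasure μ] :
    Measurable (fun t => μ.real (Set.Iic t)) := by
  apply Monotone.measurable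
  intro a b h
  exact measureReal_mono (Set.Iic_subset_Iic.2 h)

lemma W_triangle (μ ν ρ : Measure ℝ) [IsFiniteMeasure μ] [IsFiniteMeasure ν] [IsFiniteMeasure ρ] :
    W μ ρ ≤ W μ ν + W ν ρ := by
  unfold W
  rw [← lintegral_add_left ((measurable_Iic μ).fun_sub (measurable_Iic ν)).enorm]
  refine lintegral_mono fun t => ?_
  refine le_trans (le_of_eq ?_) (enorm_add_le _ _)
  congr 1; ring

lemma conv_Iic (σ μ : Measure ℝ) [IsProbabilityMeasure μ] [IsProbabilityMeasure σ] (t : ℝ) :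
    (σ ∗ μ).real (Set.Iic t) = ∫ s, μ.real (Set.Iic (t - s)) ∂σ := by
  rw [← integral_ind, integral_conv (integrable_ind _ t)]
  congr 1; funext s
  rw [← integral_ind]
  congr 1; funext x
  simp only [ind]
  congr 1
  simp only [eq_iff_iff]
  constructor <;> intro h <;> linarith

lemma W_conv (σ μ ν : Measure ℝ) [IsProbabilityMeasure μ] [IsProbabilityMeasure ν]
    [IsProbabilityMeasure σ] : W (σ ∗ μ) (σ ∗ ν) ≤ W μ ν := by
  unfold W
  have hi : ∀ (ρ : Measure ℝ) [IsProbabilityMeasure ρ] (t : ℝ),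
      Integrable (fun s => ρ.real (Set.Iic (t - s))) σ := by
    intro ρ _ t
    refine Integrable.of_bound
      ((measurable_Iic ρ).comp (measurable_const.sub measurable_id)).aestronglyMeasurable 1 ?_
    filter_upwards with x
    rw [Real.norm_of_nonneg measureReal_nonneg]
    exact measureReal_le_one
  calc _ ≤ ∫⁻ t, ∫⁻ s, ‖μ.real (Set.Iic (t - s)) - ν.real (Set.Iic (t - s))‖ₑ ∂σ := by
        refine lintegral_mono fun t => ?_
        rw [conv_Iic, conv_Iic, ← integral_sub (hi μ t) (hi ν t)]
        exact enorm_integral_le_lintegral_enorm _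
    _ = ∫⁻ s, ∫⁻ t, ‖μ.real (Set.Iic (t - s)) - ν.real (Set.Iic (t - s))‖ₑ ∂volume ∂σ := by
        apply lintegral_lintegral_swap
        apply Measurable.aemeasurable
        exact (((measurable_Iic μ).comp (measurable_fst.sub measurable_snd)).sub
          ((measurable_Iic ν).comp (measurable_fst.sub measurable_snd))).enorm
    _ = ∫⁻ s, ∫⁻ t, ‖μ.real (Set.Iic t) - ν.real (Set.Iic t)‖ₑ ∂volume ∂σ := by
        congr 1; funext s
        exact lintegral_sub_right_eq_self
          (fun t => ‖μ.real (Set.Iic t) - ν.real (Set.Iic t)‖ₑ) s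
    _ = _ := by simp

lemma W_density (μ ν : Measure ℝ) (f g : ℝ → ℝ) (hf : Integrable f) (hg : Integrable g)
    (hfm : Measurable f) (hgm : Measurable g)
    (h : ∫ x, f x = ∫ x, g x) (hμ : ∀ t, μ.real (Set.Iic t) = ∫ x, ind t x * f x)
    (hν : ∀ t, ν.real (Set.Iic t) = ∫ x, ind t x * g x) :
    W μ ν ≤ ∫⁻ x, ‖x‖ₑ * ‖f x - g x‖ₑ := by
  have hi : ∀ (f : ℝ → ℝ) (_ : Integrable f) (t : ℝ), Integrable (fun x => ind t x * f x) := by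
    intro f hf t
    refine hf.bdd_mul (c := 1) (measurable_ind_right t).aestronglyMeasurable ?_
    filter_upwards with x using abs_ind_le t x
  calc W μ ν ≤ ∫⁻ t, ∫⁻ x, ‖ind t x - ind t 0‖ₑ * ‖f x - g x‖ₑ := by
        refine lintegral_mono fun t => ?_
        have : μ.real (Set.Iic t) - ν.real (Set.Iic t)
            = ∫ x, (ind t x - ind t 0) * (f x - g x) := by
          have e : (fun x => (ind t x - ind t 0) * (f x - g x)) =
            fun x => (ind t x * f x - ind t x * g x) - ind t 0 * (f x - g x) := by
              funext x; ring
          rw [e, integral_sub (f := fun x => ind t x * f x - ind t x * g x)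
            (g := fun x => ind t 0 * (f x - g x)) ((hi f hf t).sub (hi g hg t)) ((hf.sub hg).const_mul _),
            integral_sub (hi f hf t) (hi g hg t), integral_const_mul, integral_sub hf hg, h,
            hμ, hν]
          simp
        simp only [this]
        refine (enorm_integral_le_lintegral_enorm _).trans_eq ?_
        simp only [enorm_mul]
    _ = ∫⁻ x, ∫⁻ t, ‖ind t x - ind t 0‖ₑ * ‖f x - g x‖ₑ := by
        apply lintegral_lintegral_swap
        apply Measurable.aemeasurable
        exact (measurable_ind.sub ((measurable_ind_left 0).comp measurable_fst)).enorm.mul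
          ((hfm.comp measurable_snd).sub (hgm.comp measurable_snd)).enorm
    _ = _ := by
        congr 1; funext x
        rw [lintegral_mul_const _ ((measurable_ind_left x).fun_sub (measurable_ind_left 0)).enorm,
          lint_ind_left]
        simp

lemma W_dirac (μ : Measure ℝ) [IsProbabilityMeasure μ] :
    W μ (Measure.dirac 0) ≤ ∫⁻ x, ‖x‖ₑ ∂μ := by
  calc W μ (Measure.dirac 0) ≤ ∫⁻ t, ∫⁻ x, ‖ind t x - ind t 0‖ₑ ∂μ := by
        refine lintegral_mono fun t => ?_
        rw [← integral_ind, ← integral_ind, integral_dirac]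
        have : ∫ x, ind t x ∂μ - ind t 0 = ∫ x, (ind t x - ind t 0) ∂μ := by
          rw [integral_sub (integrable_ind _ t) (integrable_const _)]; simp
        rw [this]
        exact enorm_integral_le_lintegral_enorm _
    _ = ∫⁻ x, ∫⁻ t, ‖ind t x - ind t 0‖ₑ ∂volume ∂μ := by
        apply lintegral_lintegral_swap
        apply Measurable.aemeasurable
        exact (measurable_ind.sub ((measurable_ind_left 0).comp measurable_fst)).enorm
    _ = _ := by simp [lint_ind_left]

lemma W_comm (μ ν : Measure ℝ) : W μ ν = W ν μ := by
  unfold W; congr 1; funext t; rw [enorm_sub_rev]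

/-- Quantile function. -/
noncomputable def quant (μ : Measure ℝ) (u : ℝ) : ℝ := sInf {t | u ≤ cdf μ t}

lemma quant_le_iff (μ : Measure ℝ) [IsProbabilityMeasure μ] {u : ℝ} (hu : u ∈ Set.Ioo (0:ℝ) 1)
    (t : ℝ) : quant μ u ≤ t ↔ u ≤ cdf μ t := by
  have hne : {t | u ≤ cdf μ t}.Nonempty := by
    obtain ⟨x, hx⟩ := ((tendsto_cdf_atTop μ).eventually (lt_mem_nhds hu.2)).exists
    exact ⟨x, hx.le⟩
  have hbd : BddBelow {t | u ≤ cdf μ t} := by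
    obtain ⟨x, hx⟩ := ((tendsto_cdf_atBot μ).eventually (gt_mem_nhds hu.1)).exists
    refine ⟨x, fun y hy => ?_⟩
    by_contra hlt
    have := monotone_cdf μ (le_of_not_ge hlt)
    simp only [Set.mem_ofPred_eq] at hy
    linarith
  constructor
  · intro h
    refine le_trans ?_ (monotone_cdf μ h)
    have hr : Filter.Tendsto (cdf μ) (nhdsWithin (quant μ u) (Set.Ioi (quant μ u)))
        (nhds (cdf μ (quant μ u))) :=
      ((cdf μ).right_continuous (quant μ u)).mono_left (nhdsWithin_mono _ Set.Ioi_subset_Ici_self)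
    refine ge_of_tendsto hr ?_
    filter_upwards [self_mem_nhdsWithin] with y hy
    obtain ⟨z, hz, hzy⟩ := exists_lt_of_csInf_lt hne hy
    exact le_trans hz (monotone_cdf μ hzy.le)
  · intro h
    exact csInf_le hbd h

noncomputable def unif : Measure ℝ := volume.restrict (Set.Ioo (0:ℝ) 1)

instance : IsProbabilityMeasure unif := ⟨by simp [unif]⟩

lemma measurable_quant (μ : Measure ℝ) [IsProbabilityMeasure μ] :
    AEMeasurable (quant μ) unif := by
  apply aemeasurable_restrict_of_monotoneOn measurableSet_Ioo
  intro a ha b hb hab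
  rw [quant_le_iff μ ha]
  exact hab.trans ((quant_le_iff μ hb _).1 le_rfl)

lemma map_quant (μ : Measure ℝ) [IsProbabilityMeasure μ] : unif.map (quant μ) = μ := by
  have : IsProbabilityMeasure (unif.map (quant μ)) :=
    Measure.isProbabilityMeasure_map (measurable_quant μ)
  refine Measure.ext_of_Iic _ _ fun t => ?_
  rw [Measure.map_apply_of_aemeasurable (measurable_quant μ) measurableSet_Iic, ← ofReal_cdf]
  rw [unif, Measure.restrict_apply' measurableSet_Ioo]
  have : quant μ ⁻¹' Set.Iic t ∩ Set.Ioo 0 1 = Set.Ioc 0 (cdf μ t) ∩ Set.Ioo 0 1 := by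
    ext u
    simp only [Set.mem_inter_iff, Set.mem_preimage, Set.mem_Iic, Set.mem_Ioc]
    constructor
    · rintro ⟨h, hu⟩
      exact ⟨⟨hu.1, (quant_le_iff μ hu t).1 h⟩, hu⟩
    · rintro ⟨h, hu⟩
      exact ⟨(quant_le_iff μ hu t).2 h.2, hu⟩
  rw [this]
  have h1 := cdf_le_one μ t
  apply le_antisymm
  · refine (measure_mono Set.inter_subset_left).trans ?_
    simp
  · calc ENNReal.ofReal (cdf μ t) = volume (Set.Ioo 0 (cdf μ t)) := by simp
      _ ≤ _ := by
        apply measure_mono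
        intro u hu
        exact ⟨⟨hu.1, hu.2.le⟩, hu.1, hu.2.trans_le h1⟩

lemma quant_dist (μ ν : Measure ℝ) [IsProbabilityMeasure μ] [IsProbabilityMeasure ν] :
    ∫⁻ u, ‖quant μ u - quant ν u‖ₑ ∂unif ≤ W μ ν := by
  calc ∫⁻ u, ‖quant μ u - quant ν u‖ₑ ∂unif
      = ∫⁻ u, ∫⁻ t, ‖ind (cdf μ t) u - ind (cdf ν t) u‖ₑ ∂volume ∂unif := by
        unfold unif
        refine setLIntegral_congr_fun measurableSet_Ioo fun u hu => ?_
        rw [← lint_ind_left]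
        congr 1; funext t
        simp only [ind, quant_le_iff μ hu, quant_le_iff ν hu]
    _ = ∫⁻ t, ∫⁻ u, ‖ind (cdf μ t) u - ind (cdf ν t) u‖ₑ ∂unif := by
        apply lintegral_lintegral_swap
        apply Measurable.aemeasurable
        have h : ∀ ρ : Measure ℝ, Measurable (fun p : ℝ × ℝ => ind (cdf ρ p.2) p.1) := fun ρ =>
          measurable_ind.comp
            (((monotone_cdf ρ).measurable.comp (measurable_snd : Measurable (Prod.snd : ℝ × ℝ → ℝ))).prodMk measurable_fst)
        exact ((h μ).sub (h ν)).enorm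
    _ ≤ ∫⁻ t, ∫⁻ u, ‖ind (cdf μ t) u - ind (cdf ν t) u‖ₑ :=
        lintegral_mono fun t => setLIntegral_le_lintegral _ _
    _ = W μ ν := by
        simp only [lint_ind_right, W, cdf_eq_real]

lemma coupling (μ ν : Measure ℝ) [IsProbabilityMeasure μ] [IsProbabilityMeasure ν] :
    ∃ ρ : Measure (ℝ × ℝ), IsProbabilityMeasure ρ ∧ ρ.map Prod.fst = μ ∧ ρ.map Prod.snd = ν ∧
      ∫⁻ p, ‖p.1 - p.2‖ₑ ∂ρ ≤ W μ ν := by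
  have hm : AEMeasurable (fun u => (quant μ u, quant ν u)) unif :=
    (measurable_quant μ).prodMk (measurable_quant ν)
  refine ⟨unif.map fun u => (quant μ u, quant ν u), Measure.isProbabilityMeasure_map hm, ?_, ?_, ?_⟩
  · rw [AEMeasurable.map_map_of_aemeasurable measurable_fst.aemeasurable hm]
    exact map_quant μ
  · rw [AEMeasurable.map_map_of_aemeasurable measurable_snd.aemeasurable hm]
    exact map_quant ν
  · rw [lintegral_map' (by fun_prop) hm]
    exact quant_dist μ ν

lemma exp_taylor (x : ℝ) (n : ℕ) :
    |Real.exp x - ∑ m ∈ Finset.range n, x ^ m / m.factorial| ≤ |x| ^ n * Real.exp |x| := by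
  have h := Complex.norm_exp_sub_sum_le_norm_mul_exp (x : ℂ) n
  rw [Complex.norm_real] at h
  have e : Complex.exp (x : ℂ) - ∑ m ∈ Finset.range n, (x : ℂ) ^ m / m.factorial
      = ((Real.exp x - ∑ m ∈ Finset.range n, x ^ m / m.factorial : ℝ) : ℂ) := by
    push_cast; rfl
  rw [e, Complex.norm_real] at h
  exact h

lemma exp_taylor2 (x : ℝ) : |Real.exp x - 1 - x| ≤ x ^ 2 * Real.exp |x| := by
  have h := exp_taylor x 2
  simp [Finset.sum_range_succ] at h
  rwa [sub_sub]

lemma cosh_taylor (x : ℝ) : |Real.cosh x - 1 - x ^ 2 / 2| ≤ x ^ 4 * Real.exp |x| := by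
  have h := exp_taylor x 4
  have h' := exp_taylor (-x) 4
  have e4 : |x| ^ 4 = x ^ 4 := by rw [show 4 = 2 * 2 by rfl, pow_mul, sq_abs, ← pow_mul]
  rw [abs_neg] at h'
  rw [e4] at h h'
  simp only [Finset.sum_range_succ, Finset.sum_range_zero, Nat.factorial] at h h'
  norm_num at h h'
  rw [Real.cosh_eq]
  rw [abs_le] at h h' ⊢
  constructor <;> nlinarith [h.1, h.2, h'.1, h'.2]

lemma inv_sqrt_taylor {e : ℝ} (h0 : 0 ≤ e) : |(√(1 + e))⁻¹ - 1 + e / 2| ≤ e ^ 2 := by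
  set s := √(1 + e) with hs
  have h1 : 1 ≤ s := by rw [hs]; apply Real.one_le_sqrt.2; linarith
  have hsq : s ^ 2 = 1 + e := Real.sq_sqrt (by linarith)
  have he : e = s ^ 2 - 1 := by linarith
  have hp : 0 < s := by linarith
  have e1 : s⁻¹ - 1 + e / 2 = (s - 1) ^ 2 * ((s + 2) / (2 * s)) := by
    rw [he]; field_simp; ring
  have e2 : e ^ 2 = (s - 1) ^ 2 * (s + 1) ^ 2 := by rw [he]; ring
  rw [e1, e2, abs_of_nonneg (by positivity)]
  apply mul_le_mul_of_nonneg_left _ (sq_nonneg _)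
  rw [div_le_iff₀ (by positivity)]
  nlinarith [mul_nonneg hp.le hp.le, mul_nonneg (mul_nonneg hp.le hp.le) hp.le]

set_option maxHeartbeats 1000000 in
lemma bracket {a : ℝ} (h0 : 0 ≤ a) (h1 : a ≤ 1) (y : ℝ) :
    |Real.exp (-a ^ 2 / 2) * Real.cosh (a * y)
      - (√(1 + a ^ 2))⁻¹ * Real.exp (a ^ 2 * y ^ 2 / (2 * (1 + a ^ 2)))|
      ≤ 3000 * a ^ 4 * Real.exp (3 * y ^ 2 / 8) := by
  set ε := a ^ 2 with hε
  have hε0 : 0 ≤ ε := sq_nonneg a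
  have hε1 : ε ≤ 1 := by rw [hε]; nlinarith
  have ha4 : a ^ 4 = ε ^ 2 := by rw [hε]; ring
  set Z := Real.exp (3 * y ^ 2 / 8) with hZ
  have hE1 : 1 ≤ Real.exp (y ^ 2 / 16) := Real.one_le_exp (by positivity)
  have hE4 : y ^ 4 ≤ 512 * Real.exp (y ^ 2 / 16) := by
    have := Real.quadratic_le_exp_of_nonneg (x := y ^ 2 / 16) (by positivity)
    nlinarith [sq_nonneg y]
  have hEZ : Real.exp (y ^ 2 / 16) ≤ Z := Real.exp_le_exp.2 (by nlinarith [sq_nonneg y])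
  have hy2 : y ^ 2 ≤ 16 * Z := by
    have := Real.add_one_le_exp (y ^ 2 / 16)
    linarith
  have hZ1 : 1 ≤ Z := hE1.trans hEZ
  have hEF : Real.exp (y ^ 2 / 16) * Real.exp (y ^ 2 / 4) ≤ Z := by
    rw [← Real.exp_add]; exact Real.exp_le_exp.2 (by nlinarith [sq_nonneg y])
  have hyF : y ^ 4 * Real.exp (y ^ 2 / 4) ≤ 512 * Z := by
    calc _ ≤ (512 * Real.exp (y ^ 2 / 16)) * Real.exp (y ^ 2 / 4) := by gcongr
      _ ≤ _ := by linarith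
  have hexpy : Real.exp |a * y| ≤ 3 * Real.exp (y ^ 2 / 4) := by
    have : |a * y| ≤ 1 + y ^ 2 / 4 := by
      rw [abs_mul, abs_of_nonneg h0]
      have := mul_le_mul_of_nonneg_right h1 (abs_nonneg y)
      nlinarith [sq_abs y, sq_nonneg (|y| / 2 - 1)]
    calc _ ≤ Real.exp (1 + y ^ 2 / 4) := Real.exp_le_exp.2 this
      _ = Real.exp 1 * Real.exp (y ^ 2 / 4) := Real.exp_add _ _
      _ ≤ _ := by gcongr; exact Real.exp_one_lt_d9.le.trans (by norm_num)
  -- first piece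
  have hr : |Real.cosh (a * y) - 1 - ε * y ^ 2 / 2| ≤ ε ^ 2 * (1536 * Z) := by
    have h := cosh_taylor (a * y)
    have e1 : (a * y) ^ 2 = ε * y ^ 2 := by rw [hε]; ring
    have e2 : (a * y) ^ 4 = ε ^ 2 * y ^ 4 := by rw [hε]; ring
    rw [e1, e2] at h
    refine h.trans ?_
    rw [mul_assoc]
    refine mul_le_mul_of_nonneg_left ?_ (sq_nonneg ε)
    calc y ^ 4 * Real.exp |a * y| ≤ y ^ 4 * (3 * Real.exp (y ^ 2 / 4)) := by gcongr
      _ ≤ _ := by linarith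
  have hs : |Real.exp (-ε / 2) - 1 + ε / 2| ≤ ε ^ 2 := by
    have h := exp_taylor2 (-ε / 2)
    have e3 : |-ε / 2| = ε / 2 := by rw [neg_div, abs_neg, abs_of_nonneg (by positivity)]
    rw [e3] at h
    have e4 : Real.exp (ε / 2) ≤ 3 := by
      calc _ ≤ Real.exp 1 := Real.exp_le_exp.2 (by linarith)
        _ ≤ 3 := Real.exp_one_lt_d9.le.trans (by norm_num)
    rw [show Real.exp (-ε / 2) - 1 + ε / 2 = Real.exp (-ε / 2) - 1 - -ε / 2 by ring]
    refine h.trans ?_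
    nlinarith [sq_nonneg ε]
  have he1 : Real.exp (-ε / 2) ≤ 1 := Real.exp_le_one_iff.2 (by linarith)
  have he0 := Real.exp_pos (-ε / 2)
  set p := Real.exp (-ε / 2)
  set r := Real.cosh (a * y) - 1 - ε * y ^ 2 / 2 with hrdef
  set s := p - 1 + ε / 2 with hsdef
  have hA : |p * Real.cosh (a * y) - 1 - ε * (y ^ 2 - 1) / 2| ≤ ε ^ 2 * (1600 * Z) := by
    have e : p * Real.cosh (a * y) - 1 - ε * (y ^ 2 - 1) / 2
        = p * r + (-(ε ^ 2 * (y ^ 2 / 4))) + s * (1 + ε * y ^ 2 / 2) := by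
      have e1 : Real.cosh (a * y) = r + 1 + ε * y ^ 2 / 2 := by rw [hrdef]; ring
      rw [e1, hsdef]; ring
    rw [e]
    have i1 : |p * r| ≤ ε ^ 2 * (1536 * Z) := by
      rw [abs_mul, abs_of_pos he0]
      exact (mul_le_of_le_one_left (abs_nonneg _) he1).trans hr
    have i2 : |-(ε ^ 2 * (y ^ 2 / 4))| ≤ ε ^ 2 * (4 * Z) := by
      rw [abs_neg, abs_of_nonneg (by positivity)]
      gcongr; linarith
    have i3 : |s * (1 + ε * y ^ 2 / 2)| ≤ ε ^ 2 * (9 * Z) := by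
      rw [abs_mul, abs_of_nonneg (by positivity : 0 ≤ 1 + ε * y ^ 2 / 2)]
      gcongr
      nlinarith [sq_nonneg y]
    refine (abs_add_three _ _ _).trans ?_
    linarith [mul_nonneg (sq_nonneg ε) (zero_le_one.trans hZ1)]
  -- second piece
  have hs2 := inv_sqrt_taylor hε0
  have hc0 : 0 ≤ (√(1 + ε))⁻¹ := by positivity
  have hc1 : (√(1 + ε))⁻¹ ≤ 1 := inv_le_one_of_one_le₀ (Real.one_le_sqrt.2 (by linarith))
  set c := (√(1 + ε))⁻¹
  set w := ε * y ^ 2 / (2 * (1 + ε)) with hw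
  have hw0 : 0 ≤ w := by positivity
  have hwe : w * (2 * (1 + ε)) = ε * y ^ 2 := by rw [hw]; field_simp
  have hw1 : w ≤ ε * y ^ 2 / 2 := by nlinarith [mul_nonneg hw0 hε0]
  have hw2 : w ≤ y ^ 2 / 4 := by
    rw [hw, div_le_iff₀ (by positivity)]
    nlinarith [sq_nonneg y]
  have hwd : |w - ε * y ^ 2 / 2| ≤ ε ^ 2 * (8 * Z) := by
    have : w - ε * y ^ 2 / 2 = -(w * ε) := by linarith
    rw [this, abs_neg, abs_of_nonneg (by positivity)]
    calc w * ε ≤ ε * y ^ 2 / 2 * ε := by gcongr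
      _ = ε ^ 2 * (y ^ 2 / 2) := by ring
      _ ≤ _ := by gcongr; linarith
  have hr2 : |Real.exp w - 1 - w| ≤ ε ^ 2 * (128 * Z) := by
    refine (exp_taylor2 w).trans ?_
    rw [abs_of_nonneg hw0]
    calc w ^ 2 * Real.exp w ≤ (ε * y ^ 2 / 2) ^ 2 * Real.exp (y ^ 2 / 4) := by gcongr
      _ = ε ^ 2 * (y ^ 4 * Real.exp (y ^ 2 / 4) / 4) := by ring
      _ ≤ _ := by gcongr; linarith
  set r' := Real.exp w - 1 - w with hr'def
  set s' := c - 1 + ε / 2 with hs'def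
  have hB : |c * Real.exp w - 1 - ε * (y ^ 2 - 1) / 2| ≤ ε ^ 2 * (200 * Z) := by
    have e : c * Real.exp w - 1 - ε * (y ^ 2 - 1) / 2
        = c * r' + (w - ε * y ^ 2 / 2) + (s' * (1 + w) - ε * w / 2) := by
      have e1 : Real.exp w = r' + 1 + w := by rw [hr'def]; ring
      rw [e1, hs'def]; ring
    rw [e]
    have i1 : |c * r'| ≤ ε ^ 2 * (128 * Z) := by
      rw [abs_mul, abs_of_nonneg hc0]
      exact (mul_le_of_le_one_left (abs_nonneg _) hc1).trans hr2
    have i3 : |s' * (1 + w)| ≤ ε ^ 2 * (9 * Z) := by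
      rw [abs_mul, abs_of_nonneg (by positivity : 0 ≤ 1 + w)]
      gcongr
      linarith
    have i4 : |ε * w / 2| ≤ ε ^ 2 * (4 * Z) := by
      rw [abs_of_nonneg (by positivity)]
      calc ε * w / 2 ≤ ε * (ε * y ^ 2 / 2) / 2 := by gcongr
        _ = ε ^ 2 * (y ^ 2 / 4) := by ring
        _ ≤ _ := by gcongr; linarith
    refine (abs_add_three _ _ _).trans ?_
    have i5 := abs_sub (s' * (1 + w)) (ε * w / 2)
    linarith [mul_nonneg (sq_nonneg ε) (zero_le_one.trans hZ1)]
  rw [ha4]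
  rw [abs_le] at hA hB ⊢
  constructor <;> linarith [mul_nonneg (sq_nonneg ε) (zero_le_one.trans hZ1), hA.1, hA.2, hB.1, hB.2]

lemma pdf_bound (k : ℝ≥0) (hk : 1 ≤ k) (x : ℝ) :
    |(gaussianPDFReal 1 k x / 2 + gaussianPDFReal (-1) k x / 2) - gaussianPDFReal 0 (k + 1) x|
      ≤ 3000 / ((k : ℝ) ^ 2 * √k) * Real.exp (-(1 / (8 * k)) * x ^ 2) := by
  have hk' : (1 : ℝ) ≤ k := by exact_mod_cast hk
  obtain ⟨κ, hκ⟩ : ∃ κ : ℝ, κ = k := ⟨_, rfl⟩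
  simp only [gaussianPDFReal, NNReal.coe_add, NNReal.coe_one]
  rw [← hκ] at hk' ⊢
  have hκ0 : 0 < κ := by linarith
  have hsq : √κ ^ 2 = κ := Real.sq_sqrt hκ0.le
  have hs1 : 1 ≤ √κ := Real.one_le_sqrt.2 hk'
  have hs0 : 0 < √κ := by linarith
  have hb := bracket (a := (√κ)⁻¹) (by positivity) (inv_le_one_of_one_le₀ hs1) (x / √κ)
  have a2 : (√κ)⁻¹ ^ 2 = κ⁻¹ := by rw [inv_pow, hsq]
  have a4 : (√κ)⁻¹ ^ 4 = (κ ^ 2)⁻¹ := by rw [← inv_pow, ← a2]; ring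
  have ay : (√κ)⁻¹ * (x / √κ) = x / κ := by
    rw [div_eq_mul_inv x κ, ← a2]; ring
  have y2 : (x / √κ) ^ 2 = x ^ 2 / κ := by rw [div_pow, hsq]
  rw [a2, a4, ay, y2] at hb
  have h2p : √(2 * π * κ) = √(2 * π) * √κ := Real.sqrt_mul (by positivity) _
  have h2p1 : √(2 * π * (κ + 1)) = √(2 * π) * √κ * √(1 + κ⁻¹) := by
    rw [← Real.sqrt_mul (by positivity), ← Real.sqrt_mul (by positivity)]
    congr 1; field_simp
  have hE : (√(2 * π * κ))⁻¹ * Real.exp (-(x - 1) ^ 2 / (2 * κ)) / 2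
      + (√(2 * π * κ))⁻¹ * Real.exp (-(x - -1) ^ 2 / (2 * κ)) / 2
      - (√(2 * π * (κ + 1)))⁻¹ * Real.exp (-(x - 0) ^ 2 / (2 * (κ + 1)))
      = ((√(2 * π))⁻¹ * (√κ)⁻¹ * Real.exp (-(x ^ 2 / (2 * κ)))) *
        (Real.exp (-κ⁻¹ / 2) * Real.cosh (x / κ)
          - (√(1 + κ⁻¹))⁻¹ * Real.exp (κ⁻¹ * (x ^ 2 / κ) / (2 * (1 + κ⁻¹)))) := by
    have e1 : Real.exp (-(x - 1) ^ 2 / (2 * κ))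
        = Real.exp (-(x ^ 2 / (2 * κ))) * Real.exp (-κ⁻¹ / 2) * Real.exp (x / κ) := by
      rw [← Real.exp_add, ← Real.exp_add]; congr 1; field_simp; ring
    have e2 : Real.exp (-(x - -1) ^ 2 / (2 * κ))
        = Real.exp (-(x ^ 2 / (2 * κ))) * Real.exp (-κ⁻¹ / 2) * Real.exp (-(x / κ)) := by
      rw [← Real.exp_add, ← Real.exp_add]; congr 1; field_simp; ring
    have e3 : Real.exp (-(x - 0) ^ 2 / (2 * (κ + 1)))
        = Real.exp (-(x ^ 2 / (2 * κ))) *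
          Real.exp (κ⁻¹ * (x ^ 2 / κ) / (2 * (1 + κ⁻¹))) := by
      rw [← Real.exp_add]; congr 1; field_simp; ring
    rw [e1, e2, e3, h2p, h2p1, Real.cosh_eq, mul_inv, mul_inv, mul_inv]
    ring
  rw [hE, abs_mul, abs_of_nonneg (by positivity)]
  have hpi : (√(2 * π))⁻¹ ≤ 1 :=
    inv_le_one_of_one_le₀ (Real.one_le_sqrt.2 (by nlinarith [Real.pi_gt_three]))
  calc _ ≤ (1 * (√κ)⁻¹ * Real.exp (-(x ^ 2 / (2 * κ)))) *
        (3000 * (κ ^ 2)⁻¹ * Real.exp (3 * (x ^ 2 / κ) / 8)) := by gcongr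
    _ = 3000 / (κ ^ 2 * √κ) *
        (Real.exp (-(x ^ 2 / (2 * κ))) * Real.exp (3 * (x ^ 2 / κ) / 8)) := by
        field_simp
    _ = _ := by
        rw [← Real.exp_add]; congr 2; field_simp; ring

lemma integral_abs_gauss {b : ℝ} (hb : 0 < b) :
    ∫ x : ℝ, |x| * Real.exp (-b * x ^ 2) = b⁻¹ := by
  have h := integral_comp_abs (f := fun x : ℝ => x * Real.exp (-b * x ^ 2))
  simp only [sq_abs] at h
  rw [h]
  have h2 := integral_rpow_mul_exp_neg_mul_rpow (p := 2) (q := 1) (b := b)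
    (by norm_num) (by norm_num) hb
  simp only [Real.rpow_one, Real.rpow_two] at h2
  rw [h2]
  norm_num
  rw [Real.rpow_neg_one]
  ring

lemma lintegral_step (k : ℝ≥0) (hk : 1 ≤ k) :
    ∫⁻ x, ‖x‖ₑ * ‖(gaussianPDFReal 1 k x / 2 + gaussianPDFReal (-1) k x / 2)
      - gaussianPDFReal 0 (k + 1) x‖ₑ ≤ ENNReal.ofReal (24000 / ((k : ℝ) * √k)) := by
  have hk' : (1 : ℝ) ≤ k := by exact_mod_cast hk
  have hb : 0 < 1 / (8 * (k : ℝ)) := by positivity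
  calc _ ≤ ∫⁻ x, ENNReal.ofReal (3000 / ((k : ℝ) ^ 2 * √k) *
        (|x| * Real.exp (-(1 / (8 * k)) * x ^ 2))) := by
        refine lintegral_mono fun x => ?_
        rw [← enorm_mul, Real.enorm_eq_ofReal_abs, abs_mul]
        apply ENNReal.ofReal_le_ofReal
        rw [mul_left_comm]
        exact mul_le_mul_of_nonneg_left (pdf_bound k hk x) (abs_nonneg x)
    _ = ENNReal.ofReal (∫ x, (3000 / ((k : ℝ) ^ 2 * √k) *
        (|x| * Real.exp (-(1 / (8 * k)) * x ^ 2)))) := by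
        rw [ofReal_integral_eq_lintegral_ofReal]
        · apply Integrable.const_mul
          refine (integrable_mul_exp_neg_mul_sq hb).abs.congr ?_
          filter_upwards with x
          rw [abs_mul, Real.abs_exp]
        · filter_upwards with x
          positivity
    _ ≤ _ := by
        rw [integral_const_mul, integral_abs_gauss hb]
        apply ENNReal.ofReal_le_ofReal
        apply le_of_eq
        field_simp
        norm_num

instance : IsProbabilityMeasure signUnif := ⟨by simp [signUnif, ENNReal.inv_two_add_inv_two]⟩

lemma measurable_sumFin (N : ℕ) : Measurable (fun b : Fin N → ℝ => ∑ i, b i) := by fun_prop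

instance (N : ℕ) : IsProbabilityMeasure (sumSigns N) :=
  Measure.isProbabilityMeasure_map (measurable_sumFin N).aemeasurable

lemma sumSigns_zero : sumSigns 0 = Measure.dirac 0 := by
  unfold sumSigns
  have h : (fun b : Fin 0 → ℝ => ∑ i, b i) = fun _ => 0 := by simp
  rw [h, Measure.map_const]
  simp

lemma sumSigns_succ (N : ℕ) : sumSigns (N + 1) = sumSigns N ∗ signUnif := by
  have h := measurePreserving_piFinSuccAbove (fun _ : Fin (N + 1) => signUnif) 0
  rw [Measure.conv_comm]
  unfold Measure.conv
  unfold sumSigns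
  have hm : (signUnif.prod ((Measure.pi fun _ : Fin N => signUnif).map fun b => ∑ i, b i))
      = (signUnif.prod (Measure.pi fun _ : Fin N => signUnif)).map
        (Prod.map id fun b => ∑ i, b i) := by
    rw [← Measure.map_prod_map _ _ measurable_id (measurable_sumFin N), Measure.map_id]
  rw [hm, Measure.map_map (by fun_prop) (by fun_prop), ← h.map_eq,
    Measure.map_map (by fun_prop) h.measurable]
  congr 1
  funext b
  simp [Fin.sum_univ_succ, MeasurableEquiv.piFinSuccAbove, Fin.tail]

/-- Bound for one replacement step. -/
noncomputable def stepD (k : ℕ) : ℝ≥0∞ :=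
  W (signUnif ∗ gaussianReal 0 k) (gaussianReal 0 1 ∗ gaussianReal 0 k)

lemma gaussian_Iic (m : ℝ) (v : ℝ≥0) (hv : v ≠ 0) (t : ℝ) :
    (gaussianReal m v).real (Set.Iic t) = ∫ x, ind t x * gaussianPDFReal m v x := by
  rw [← integral_ind, integral_gaussianReal_eq_integral_smul hv]
  congr 1; funext x; simp [mul_comm]

lemma sign_conv (v : ℝ≥0) : signUnif ∗ gaussianReal 0 v =
    (2 : ℝ≥0∞)⁻¹ • gaussianReal 1 v + (2 : ℝ≥0∞)⁻¹ • gaussianReal (-1) v := by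
  unfold signUnif
  rw [Measure.add_conv, Measure.conv_smul_left, Measure.conv_smul_left, Measure.dirac_conv,
    Measure.dirac_conv, gaussianReal_map_const_add, gaussianReal_map_const_add]
  simp

lemma stepD_le (k : ℕ) (hk : 1 ≤ k) : stepD k ≤ ENNReal.ofReal (24000 / ((k : ℝ) * √k)) := by
  unfold stepD
  have hv : (k : ℝ≥0) ≠ 0 := by exact_mod_cast (by omega : k ≠ 0)
  have hv1 : (k : ℝ≥0) + 1 ≠ 0 := by positivity
  have hk1 : (1 : ℝ≥0) ≤ k := by exact_mod_cast hk
  rw [gaussianReal_conv_gaussianReal, sign_conv, add_comm (1 : ℝ≥0), add_zero]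
  have hi : ∀ m : ℝ, ∀ t : ℝ, Integrable (fun x => ind t x * (gaussianPDFReal m k x / 2)) := by
    intro m t
    refine ((integrable_gaussianPDFReal m k).div_const 2).bdd_mul (c := 1)
      (measurable_ind_right t).aestronglyMeasurable ?_
    filter_upwards with x using abs_ind_le t x
  have hii : ∀ m : ℝ, Integrable (fun x => gaussianPDFReal m k x / 2) := fun m =>
    (integrable_gaussianPDFReal m k).div_const 2
  refine (W_density _ _ (fun x => gaussianPDFReal 1 k x / 2 + gaussianPDFReal (-1) k x / 2)
    (gaussianPDFReal 0 (k + 1)) ((hii _).add (hii _)) (integrable_gaussianPDFReal _ _)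
    (((measurable_gaussianPDFReal _ _).div_const 2).add
      ((measurable_gaussianPDFReal _ _).div_const 2))
    (measurable_gaussianPDFReal _ _) ?_ ?_ ?_).trans
    (by simpa using lintegral_step k hk1)
  · rw [integral_add (hii _) (hii _), integral_div, integral_div,
      integral_gaussianPDFReal_eq_one _ hv, integral_gaussianPDFReal_eq_one _ hv,
      integral_gaussianPDFReal_eq_one _ hv1]
    norm_num
  · intro t
    simp only [mul_add]
    have hf : ∀ m : ℝ, ((2 : ℝ≥0∞)⁻¹ • gaussianReal m k) (Set.Iic t) ≠ ∞ := by
      intro m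
      rw [Measure.smul_apply, smul_eq_mul]
      exact ENNReal.mul_ne_top (by simp) (measure_ne_top _ _)
    rw [integral_add (hi _ t) (hi _ t), measureReal_add_apply (hf _) (hf _), measureReal_ennreal_smul_apply,
      measureReal_ennreal_smul_apply, gaussian_Iic _ _ hv, gaussian_Iic _ _ hv]
    simp only [← mul_div_assoc, integral_div]
    simp
    ring
  · intro t
    exact gaussian_Iic _ _ hv1 t

lemma stepD_zero : stepD 0 ≠ ∞ := by
  unfold stepD
  have h : gaussianReal 0 ((0 : ℕ) : ℝ≥0) = Measure.dirac 0 := by simp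
  rw [h, Measure.conv_dirac_zero, Measure.conv_dirac_zero]
  refine ne_top_of_le_ne_top ?_ (W_triangle _ (Measure.dirac 0) _)
  rw [W_comm (Measure.dirac 0)]
  refine ENNReal.add_ne_top.2 ⟨ne_top_of_le_ne_top ?_ (W_dirac _),
    ne_top_of_le_ne_top ?_ (W_dirac _)⟩
  · simp [signUnif, lintegral_add_measure, lintegral_smul_measure]
  · have : Integrable (fun x : ℝ => x) (gaussianReal 0 1) :=
      (memLp_id_gaussianReal (μ := 0) (v := 1) 1).integrable (by simp)
    exact this.2.ne

lemma tsum_stepD : ∑' k, stepD k ≠ ∞ := by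
  rw [tsum_eq_zero_add' ENNReal.summable]
  refine ENNReal.add_ne_top.2 ⟨stepD_zero, ?_⟩
  have hs : Summable fun k : ℕ => 24000 * (1 / ((k + 1 : ℕ) : ℝ) ^ (3 / 2 : ℝ)) := by
    apply Summable.mul_left
    exact (summable_nat_add_iff 1).2 (Real.summable_one_div_nat_rpow.2 (by norm_num))
  refine ne_top_of_le_ne_top (hs.tsum_ofReal_ne_top) (ENNReal.tsum_le_tsum fun k => ?_)
  refine (stepD_le (k + 1) (by omega)).trans (ENNReal.ofReal_le_ofReal (le_of_eq ?_))
  have hp : (0 : ℝ) < ((k + 1 : ℕ) : ℝ) := by positivity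
  rw [show (3 / 2 : ℝ) = 1 + 1 / 2 by norm_num, Real.rpow_add hp, Real.rpow_one, Real.sqrt_eq_rpow]
  ring

lemma W_self (μ : Measure ℝ) : W μ μ = 0 := by simp [W]

lemma telescoping (j : ℕ) : ∀ k : ℕ, W (sumSigns j ∗ gaussianReal 0 k) (gaussianReal 0 (j + k : ℕ))
    ≤ ∑ i ∈ Finset.range j, stepD (k + i) := by
  induction j with
  | zero =>
    intro k
    rw [sumSigns_zero, Measure.dirac_zero_conv]
    simp [W_self]
  | succ j ih =>
    intro k
    refine (W_triangle _ (sumSigns j ∗ gaussianReal 0 (k + 1 : ℕ)) _).trans ?_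
    rw [Finset.sum_range_succ', add_comm]
    refine add_le_add ?_ ?_
    · have := ih (k + 1)
      rw [show j + (k + 1) = j + 1 + k by ring] at this
      refine this.trans_eq (Finset.sum_congr rfl fun i _ => ?_)
      congr 1; ring
    · have e : gaussianReal 0 (k + 1 : ℕ) = gaussianReal 0 1 ∗ gaussianReal 0 k := by
        rw [gaussianReal_conv_gaussianReal]; push_cast; rw [add_comm (1 : ℝ≥0), add_zero]
      rw [sumSigns_succ, Measure.conv_assoc, e]
      exact W_conv _ _ _

lemma W_final (N : ℕ) : W (gaussianReal 0 N) (sumSigns N) ≤ ∑' k, stepD k := by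
  have h := telescoping N 0
  have e : gaussianReal 0 ((0 : ℕ) : ℝ≥0) = Measure.dirac 0 := by simp
  rw [e, Measure.conv_dirac_zero, W_comm] at h
  refine h.trans ?_
  simp only [zero_add]
  exact ENNReal.sum_le_tsum _

/-- Theorem 3.9: there is a coupling `(G, H_N)` of the standard Gaussian and a
sum of `N` i.i.d. uniform signs such that
`Pr[|G - H_N/√N| ≤ C·N^{-1/4}] ≥ 1 - C·N^{-1/4}` for an absolute constant
`C > 0`. -/
theorem stmt10 :
    ∃ C : ℝ, 0 < C ∧ ∀ N : ℕ, 1 ≤ N →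
      ∃ μ : Measure (ℝ × ℝ), IsProbabilityMeasure μ ∧
        μ.map Prod.fst = gaussianReal 0 1 ∧
        μ.map Prod.snd = sumSigns N ∧
        ENNReal.ofReal (1 - C * (N : ℝ) ^ (-(1 / 4 : ℝ))) ≤
          μ {p | |p.1 - p.2 / Real.sqrt N| ≤ C * (N : ℝ) ^ (-(1 / 4 : ℝ))} := by
  obtain ⟨K, hK⟩ : ∃ K : ℝ≥0, ∑' k, stepD k = K := ⟨_, (ENNReal.coe_toNNReal tsum_stepD).symm⟩
  refine ⟨(K : ℝ) + 1, by positivity, fun N hN => ?_⟩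
  obtain ⟨ρ, hρ, h1, h2, hd⟩ := coupling (gaussianReal 0 N) (sumSigns N)
  replace hd := (hd.trans (W_final N)).trans_eq hK
  have hN0 : (0 : ℝ) < N := by exact_mod_cast hN
  have hs0 : 0 < √(N : ℝ) := Real.sqrt_pos.2 hN0
  have hm : Measurable (fun p : ℝ × ℝ => (p.1 / √(N : ℝ), p.2)) := by fun_prop
  refine ⟨ρ.map fun p => (p.1 / √(N : ℝ), p.2), Measure.isProbabilityMeasure_map hm.aemeasurable,
    ?_, ?_, ?_⟩
  · rw [Measure.map_map measurable_fst hm]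
    have : (Prod.fst ∘ fun p : ℝ × ℝ => (p.1 / √(N : ℝ), p.2)) = (fun x => x / √(N : ℝ)) ∘ Prod.fst :=
      rfl
    rw [this, ← Measure.map_map (by fun_prop) measurable_fst, h1, gaussianReal_map_div_const]
    congr 1
    · simp
    · ext
      simp only [NNReal.coe_div, NNReal.coe_natCast, NNReal.coe_one, NNReal.coe_mk]
      rw [Real.sq_sqrt hN0.le]
      field_simp
  · rw [Measure.map_map measurable_snd hm]
    exact h2
  · set δ : ℝ := (N : ℝ) ^ (-(1 / 4 : ℝ)) with hδ
    have hδ0 : 0 < δ := Real.rpow_pos_of_pos hN0 _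
    set C : ℝ := (K : ℝ) + 1 with hC
    have hC0 : 0 < C := by positivity
    have hms : MeasurableSet {p : ℝ × ℝ | |p.1 - p.2 / √(N : ℝ)| ≤ C * δ} :=
      measurableSet_le (by fun_prop) measurable_const
    rw [Measure.map_apply hm hms]
    set S := (fun p : ℝ × ℝ => (p.1 / √(N : ℝ), p.2)) ⁻¹'
      {p : ℝ × ℝ | |p.1 - p.2 / √(N : ℝ)| ≤ C * δ} with hS
    have hSm : MeasurableSet S := hm hms
    have hδN : √(N : ℝ) * δ * δ = 1 := by
      rw [hδ, Real.sqrt_eq_rpow, ← Real.rpow_add hN0, ← Real.rpow_add hN0]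
      norm_num
    have hc : ρ Sᶜ ≤ ENNReal.ofReal (C * δ) := by
      have hpos : 0 < C * δ * √(N : ℝ) := by positivity
      have hsub : Sᶜ ⊆ {p : ℝ × ℝ | ENNReal.ofReal (C * δ * √(N : ℝ)) ≤ ‖p.1 - p.2‖ₑ} := by
        intro p hp
        have hp' : C * δ < |p.1 / √(N : ℝ) - p.2 / √(N : ℝ)| := not_le.1 hp
        rw [← sub_div, abs_div, abs_of_pos hs0, lt_div_iff₀ hs0] at hp'
        change ENNReal.ofReal (C * δ * √(N : ℝ)) ≤ ‖p.1 - p.2‖ₑ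
        rw [Real.enorm_eq_ofReal_abs]
        exact ENNReal.ofReal_le_ofReal hp'.le
      refine (measure_mono hsub).trans ?_
      refine (meas_ge_le_lintegral_div (by fun_prop) (by simpa using hpos)
        ENNReal.ofReal_ne_top).trans ?_
      rw [ENNReal.div_le_iff (by simpa using hpos) ENNReal.ofReal_ne_top,
        ← ENNReal.ofReal_mul (by positivity)]
      refine hd.trans ?_
      rw [← ENNReal.ofReal_coe_nnreal]
      apply ENNReal.ofReal_le_ofReal
      have : C * δ * (C * δ * √(N : ℝ)) = C ^ 2 := by
        linear_combination C ^ 2 * hδN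
      rw [this, hC]
      nlinarith [K.coe_nonneg]
    have hadd := prob_add_prob_compl (μ := ρ) hSm
    rw [ENNReal.ofReal_sub _ (by positivity), ENNReal.ofReal_one, ← hadd]
    exact tsub_le_iff_right.2 (add_le_add_right hc _)
end

section
/- Fix an integer D ≥ 1 and a constant C > 0. There is a constant C' > 0 (depending only on D and C) such that the following holds for all n ≥ 2. Set N = n^{24D²}. Let (y,z) ∈ ℝ^n × ℝ^n be a random pair whose coordinate pairs (y_i, z_i), i ∈ [n], are i.i.d. draws from a joint distribution on ℝ² in which y_i has the standard N(0,1) Gaussian distribution, z_i has the distribution of (Σ_{j=1}^N b_j)/√N with b_j i.i.d. uniform on {−1,1}, and Pr[|y_i − z_i| ≤ C·N^{−1/4}] ≥ 1 − C·N^{−1/4}. Then for every nonconstant degree-D polynomial f(x_1,…,x_n) = Σ_{multisets S ⊆ [n], |S| ≤ D} c_S ∏_{i∈S} x_i, one has Pr[sgn(f(y)) ≠ sgn(f(z))] ≤ C'/n. -/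
open MeasureTheory ProbabilityTheory Real
open scoped ENNReal NNReal

/-- Evaluation of a polynomial given by its (finitely supported) coefficient
function on multisets of variable indices. -/
noncomputable def polyEval {ι : Type*} (c : Multiset ι →₀ ℝ) (x : ι → ℝ) : ℝ :=
  ∑ S ∈ c.support, c S * (S.map x).prod

/-- The distribution of `(Σ_{j=1}^N b_j)/√N` for i.i.d. uniform signs `b_j`. -/
noncomputable def scaledSumSigns (N : ℕ) : Measure ℝ :=
  (Measure.pi fun _ : Fin N => signUnif).map fun b => (∑ j, b j) / Real.sqrt N


open Polynomial in
theorem coef_bound (n : ℝ) (hn : 2 ≤ n) (d : ℕ) : ∀ (p : ℝ[X]) (ε : ℝ) (E : Set ℝ),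
    p.natDegree ≤ d → (∀ t ∈ E, |t| ≤ n) → (∀ t ∈ E, |p.eval t| ≤ ε) →
    ENNReal.ofReal (d * (2 / n)) < volume E → ∀ k, |p.coeff k| ≤ ε * (4 * n ^ 2) ^ d := by
  have hn0 : 0 < n := by linarith
  induction d with
  | zero =>
    intro p ε E hp hE hpE hv k
    have hne : E.Nonempty := by
      by_contra h
      rw [Set.not_nonempty_iff_eq_empty] at h
      simp [h] at hv
    obtain ⟨t, ht⟩ := hne
    have h1 := hpE t ht
    rw [Polynomial.eq_C_of_natDegree_le_zero hp] at h1 ⊢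
    simp only [eval_C, pow_zero, mul_one] at h1 ⊢
    rw [coeff_C]
    split_ifs
    · exact h1
    · simp; exact (abs_nonneg _).trans h1
  | succ d ih =>
    intro p ε E hp hE hpE hv k
    have hne : E.Nonempty := by
      by_contra h
      rw [Set.not_nonempty_iff_eq_empty] at h
      simp [h] at hv
    obtain ⟨a, ha⟩ := hne
    have hε : 0 ≤ ε := (abs_nonneg _).trans (hpE a ha)
    set q := p /ₘ (X - C a) with hq
    have hpq : p = C (p.eval a) + (X - C a) * q := by
      have := Polynomial.modByMonic_add_div p (X - C a)
      rw [Polynomial.modByMonic_X_sub_C_eq_C_eval] at this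
      exact this.symm
    have hqd : q.natDegree ≤ d := by
      rw [hq, Polynomial.natDegree_divByMonic _ (monic_X_sub_C a), natDegree_X_sub_C]
      omega
    have hv' : ENNReal.ofReal (d * (2 / n)) < volume (E \ Metric.ball a (1 / n)) := by
      by_contra hcon
      push Not at hcon
      have h1 : volume E ≤ volume (E \ Metric.ball a (1 / n)) + volume (Metric.ball a (1 / n)) := by
        refine (measure_mono ?_).trans (measure_union_le _ _)
        intro x hx
        by_cases h : x ∈ Metric.ball a (1 / n)
        · exact Or.inr h
        · exact Or.inl ⟨hx, h⟩
      have h2 : volume E ≤ ENNReal.ofReal (d * (2 / n)) + ENNReal.ofReal (2 * (1 / n)) := by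
        refine h1.trans (add_le_add hcon ?_)
        rw [Real.volume_ball]
      rw [← ENNReal.ofReal_add (by positivity) (by positivity)] at h2
      refine absurd (h2.trans_lt' hv) ?_
      rw [not_lt]
      apply ENNReal.ofReal_le_ofReal
      push_cast
      apply le_of_eq
      ring
    have key := ih q (2 * ε * n) (E \ Metric.ball a (1 / n)) hqd (fun t ht => hE t ht.1) (by
      intro t ht
      have h1 : p.eval t = p.eval a + (t - a) * q.eval t := by
        conv_lhs => rw [hpq]
        simp
      have h2 : 1 / n ≤ |t - a| := by
        have := ht.2
        simpa [Real.dist_eq] using this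
      have h3 : |t - a| * |q.eval t| ≤ 2 * ε := by
        rw [← abs_mul]
        have : (t - a) * q.eval t = p.eval t - p.eval a := by rw [h1]; ring
        rw [this]
        have := abs_sub (p.eval t) (p.eval a)
        linarith [hpE t ht.1, hpE a ha]
      have h4 : 1 / n * |q.eval t| ≤ 2 * ε := (mul_le_mul_of_nonneg_right h2 (abs_nonneg _)).trans h3
      rw [one_div, inv_mul_le_iff₀ hn0] at h4
      linarith) hv'
    set K := (4 * n ^ 2) ^ d with hK
    have hK1 : 1 ≤ K := one_le_pow₀ (by nlinarith)
    have haE := hE a ha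
    have hcs : |p.coeff k| ≤ ε + (1 + n) * (2 * ε * n * K) := by
      have e1 : p.coeff k = (C (p.eval a)).coeff k + ((X * q).coeff k - a * q.coeff k) := by
        conv_lhs => rw [hpq]
        rw [sub_mul, coeff_add, coeff_sub, coeff_C_mul]
      have e2 : |(C (p.eval a)).coeff k| ≤ ε := by
        rw [coeff_C]
        split_ifs
        · exact hpE a ha
        · simpa using hε
      have e3 : |(X * q).coeff k| ≤ 2 * ε * n * K := by
        cases k with
        | zero => simp; positivity
        | succ k => rw [coeff_X_mul]; exact key k
      have e4 : |a * q.coeff k| ≤ n * (2 * ε * n * K) := by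
        rw [abs_mul]
        exact mul_le_mul haE (key k) (abs_nonneg _) hn0.le
      rw [e1]
      have f1 := abs_add_le ((C (p.eval a)).coeff k) ((X * q).coeff k - a * q.coeff k)
      have f2 := abs_sub ((X * q).coeff k) (a * q.coeff k)
      linarith
    refine hcs.trans ?_
    rw [pow_succ, ← hK]
    have : ε ≤ ε * K := le_mul_of_one_le_right hε hK1
    have h5 : 0 ≤ ε * K := by positivity
    have h6 : ε * K * (1 + 2 * n * (1 + n)) ≤ ε * K * (4 * n ^ 2) :=
      mul_le_mul_of_nonneg_left (by nlinarith) h5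
    linarith

theorem gauss_le_volume (E : Set ℝ) : gaussianReal 0 1 E ≤ volume E := by
  rw [gaussianReal_apply 0 (by norm_num) E]
  calc ∫⁻ x in E, gaussianPDF 0 1 x ≤ ∫⁻ x in E, 1 := by
        apply lintegral_mono
        intro x
        simp only [gaussianPDF, ENNReal.ofReal_le_one, gaussianPDFReal]
        have h1 : (√(2 * π * (1:ℝ≥0)))⁻¹ ≤ 1 := by
          apply inv_le_one_of_one_le₀
          rw [Real.one_le_sqrt]
          have := Real.pi_gt_three
          simp; linarith
        have h2 : rexp (-(x - 0) ^ 2 / (2 * (1:ℝ≥0))) ≤ 1 := by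
          rw [Real.exp_le_one_iff]
          have := sq_nonneg (x - 0)
          apply div_nonpos_of_nonpos_of_nonneg
          · linarith
          · positivity
        exact mul_le_one₀ h1 (by positivity) h2
    _ = volume E := by simp

theorem gauss_tail (n : ℝ) (hn : 2 ≤ n) : gaussianReal 0 1 {t | n < |t|} ≤ ENNReal.ofReal (1 / n ^ 2) := by
  have := meas_ge_le_variance_div_sq (μ := gaussianReal 0 1) (X := id) (memLp_id_gaussianReal 2) (c := n) (by linarith)
  simp only [variance_id_gaussianReal, id, integral_id_gaussianReal, sub_zero] at this
  exact (measure_mono (t := {t : ℝ | n ≤ |t|}) (fun t (ht : n < |t|) => ht.le)).trans (by simpa using this)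

theorem count_sum {n : ℕ} (hn : 2 ≤ n) (D : ℕ) (F : Finset (Multiset (Fin n)))
    (hF : ∀ R ∈ F, 1 ≤ Multiset.card R ∧ Multiset.card R ≤ D) :
    ∑ R ∈ F, ((n : ℝ) ^ Multiset.card R)⁻¹ ≤ D := by
  classical
  have hn0 : (0:ℝ) < n := by positivity
  rw [← Finset.sum_fiberwise_of_maps_to (s := F) (t := Finset.Icc 1 D) (g := fun R => Multiset.card R)
    (fun R hR => Finset.mem_Icc.2 (hF R hR))]
  calc _ ≤ ∑ r ∈ Finset.Icc 1 D, (1:ℝ) := by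
        apply Finset.sum_le_sum
        intro r _
        have h1 : ∑ R ∈ F with Multiset.card R = r, ((n : ℝ) ^ Multiset.card R)⁻¹
            = ∑ R ∈ F with Multiset.card R = r, ((n : ℝ) ^ r)⁻¹ :=
          Finset.sum_congr rfl (fun R hR => by rw [(Finset.mem_filter.1 hR).2])
        rw [h1, Finset.sum_const, nsmul_eq_mul]
        have h2 : (F.filter (fun R => Multiset.card R = r)).card ≤ n ^ r := by
          calc _ ≤ (Finset.univ.image (fun v : Fin r → Fin n => (Finset.univ : Finset (Fin r)).val.map v)).card := by
                apply Finset.card_le_card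
                intro R hR
                have hr := (Finset.mem_filter.1 hR).2
                rw [Finset.mem_image]
                obtain ⟨l, rfl⟩ := Quot.exists_rep R
                change l.length = r at hr
                subst hr
                refine ⟨l.get, Finset.mem_univ _, ?_⟩
                rw [Fin.univ_val_map, List.ofFn_get]
                rfl
            _ ≤ _ := by
                refine Finset.card_image_le.trans ?_
                simp
        rw [← div_eq_mul_inv, div_le_one (by positivity)]
        exact_mod_cast h2
    _ = D := by simp

theorem prod_bound {n : ℕ} (M δ : ℝ) (hM : 1 ≤ M) (y z : Fin n → ℝ) (hδ : 0 ≤ δ)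
    (hy : ∀ i, |y i| ≤ M) (hz : ∀ i, |z i| ≤ M) (hyz : ∀ i, |y i - z i| ≤ δ) (R : Multiset (Fin n)) :
    |(R.map z).prod| ≤ M ^ Multiset.card R ∧
    |(R.map y).prod - (R.map z).prod| ≤ Multiset.card R * M ^ Multiset.card R * δ := by
  have hM0 : 0 ≤ M := by linarith
  induction R using Multiset.induction_on with
  | empty => simp
  | cons a R ih =>
    obtain ⟨h1, h2⟩ := ih
    simp only [Multiset.map_cons, Multiset.prod_cons, Multiset.card_cons]
    set P := (R.map y).prod
    set Q := (R.map z).prod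
    set r := Multiset.card R
    constructor
    · rw [abs_mul, pow_succ, mul_comm]
      exact mul_le_mul h1 (hz a) (abs_nonneg _) (by positivity)
    · have e : y a * P - z a * Q = y a * (P - Q) + (y a - z a) * Q := by ring
      rw [e]
      refine (abs_add_le _ _).trans ?_
      rw [abs_mul, abs_mul]
      have a1 : |y a| * |P - Q| ≤ M * (r * M ^ r * δ) := mul_le_mul (hy a) h2 (abs_nonneg _) hM0
      have a2 : |y a - z a| * |Q| ≤ δ * M ^ r := mul_le_mul (hyz a) h1 (abs_nonneg _) hδ
      have a3 : δ * M ^ r ≤ δ * M ^ r * M := le_mul_of_one_le_right (by positivity) hM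
      push_cast
      calc _ ≤ M * (r * M ^ r * δ) + δ * M ^ r * M := by linarith
        _ = _ := by ring

/-- The coefficient function: collects the terms whose exponents on `T` agree with those of `S`. -/
noncomputable def gT {n : ℕ} (c : Multiset (Fin n) →₀ ℝ) (S : Multiset (Fin n)) (T : Finset (Fin n))
    (x : Fin n → ℝ) : ℝ :=
  ∑ R ∈ c.support.filter (fun R => ∀ j ∈ T, R.count j = S.count j),
    c R * ∏ j ∈ Tᶜ, x j ^ R.count j

theorem gT_empty {n : ℕ} (c : Multiset (Fin n) →₀ ℝ) (S : Multiset (Fin n)) (x : Fin n → ℝ) :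
    gT c S ∅ x = polyEval c x := by
  simp only [gT, polyEval, Finset.notMem_empty, false_imp_iff, implies_true, Finset.filter_true,
    Finset.compl_empty]
  refine Finset.sum_congr rfl (fun R _ => ?_)
  rw [Finset.prod_multiset_map_count]
  congr 1
  symm
  apply Finset.prod_subset (Finset.subset_univ _)
  intro j _ hj
  rw [Multiset.count_eq_zero_of_notMem (by simpa using hj), pow_zero]

theorem gT_meas {n : ℕ} (c : Multiset (Fin n) →₀ ℝ) (S : Multiset (Fin n)) (T : Finset (Fin n)) :
    Measurable (gT c S T) := by
  unfold gT
  fun_prop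

open Polynomial in
theorem gT_step {n : ℕ} (D : ℕ) (c : Multiset (Fin n) →₀ ℝ) (hc : ∀ S ∈ c.support, Multiset.card S ≤ D)
    (S : Multiset (Fin n)) (T : Finset (Fin n)) (i : Fin n) (hi : i ∉ T) (x : Fin n → ℝ) :
    ∃ p : ℝ[X], p.natDegree ≤ D ∧ (∀ t, p.eval t = gT c S T (Function.update x i t)) ∧
      p.coeff (S.count i) = gT c S (insert i T) x := by
  refine ⟨∑ R ∈ c.support.filter (fun R => ∀ j ∈ T, R.count j = S.count j),
    C (c R * ∏ j ∈ (insert i T)ᶜ, x j ^ R.count j) * X ^ R.count i, ?_, ?_, ?_⟩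
  · apply natDegree_sum_le_of_forall_le
    intro R hR
    refine (natDegree_C_mul_X_pow_le _ _).trans ?_
    exact (Multiset.count_le_card _ _).trans (hc R (Finset.mem_filter.1 hR).1)
  · intro t
    rw [eval_finsetSum, gT]
    refine Finset.sum_congr rfl (fun R _ => ?_)
    simp only [eval_mul, eval_C, eval_pow, eval_X]
    rw [mul_assoc]
    congr 1
    have h1 : i ∈ Tᶜ := by simpa using hi
    rw [← Finset.mul_prod_erase _ _ h1, Finset.compl_insert, Function.update_self, mul_comm]
    congr 1
    refine Finset.prod_congr rfl (fun j hj => ?_)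
    rw [Function.update_of_ne (Finset.ne_of_mem_erase hj)]
  · rw [finsetSum_coeff, gT]
    simp only [coeff_C_mul_X_pow]
    rw [← Finset.sum_filter, Finset.filter_filter]
    refine Finset.sum_congr ?_ (fun _ _ => rfl)
    ext R
    simp only [Finset.mem_filter, Finset.forall_mem_insert]
    grind

theorem gT_update {n : ℕ} (c : Multiset (Fin n) →₀ ℝ)
    (S : Multiset (Fin n)) (T : Finset (Fin n)) (i : Fin n) (x : Fin n → ℝ) (t : ℝ) :
    gT c S (insert i T) (Function.update x i t) = gT c S (insert i T) x := by
  unfold gT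
  refine Finset.sum_congr rfl (fun R _ => ?_)
  congr 1
  refine Finset.prod_congr rfl (fun j hj => ?_)
  rw [Function.update_of_ne]
  rintro rfl
  simp at hj

theorem step_measure {n : ℕ} (hn : 2 ≤ n) (D : ℕ) (c : Multiset (Fin n) →₀ ℝ)
    (hc : ∀ S ∈ c.support, Multiset.card S ≤ D)
    (S : Multiset (Fin n)) (T : Finset (Fin n)) (i : Fin n) (hi : i ∉ T) (A : ℝ) (hA : 0 < A) :
    (Measure.pi fun _ : Fin n => gaussianReal 0 1)
      {y | |y i| ≤ n ∧ A ≤ |gT c S (insert i T) y| ∧ |gT c S T y| ≤ (2 * (4 * (n:ℝ) ^ 2) ^ D)⁻¹ * A} ≤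
      ENNReal.ofReal (D * (2 / n)) := by
  have hn' : (2:ℝ) ≤ n := by exact_mod_cast hn
  set E := {y : Fin n → ℝ | |y i| ≤ n ∧ A ≤ |gT c S (insert i T) y| ∧ |gT c S T y| ≤ (2 * (4 * (n:ℝ) ^ 2) ^ D)⁻¹ * A} with hE
  have m1 := gT_meas c S T
  have m2 := gT_meas c S (insert i T)
  have hEm : MeasurableSet E := by
    exact (measurableSet_le (f := fun y : Fin n → ℝ => |y i|) (by fun_prop) measurable_const).inter
      ((measurableSet_le measurable_const (continuous_abs.measurable.comp m2)).inter
        (measurableSet_le (continuous_abs.measurable.comp m1) measurable_const))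
  rw [← lintegral_indicator_one hEm]
  have : ENNReal.ofReal (D * (2 / n)) = ∫⁻ _ : Fin n → ℝ, ENNReal.ofReal (D * (2 / n))
      ∂(Measure.pi fun _ : Fin n => gaussianReal 0 1) := by simp
  rw [this]
  refine lintegral_le_of_lmarginal_le {i} (measurable_one.indicator hEm) measurable_const ?_
  rw [lmarginal_singleton, lmarginal_singleton]
  intro x
  simp only [lintegral_const, measure_univ, mul_one]
  have hup : Measurable (fun t : ℝ => Function.update x i t) := measurable_update x
  have h1 : ∀ t, E.indicator (1 : (Fin n → ℝ) → ℝ≥0∞) (Function.update x i t) =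
    ((fun t : ℝ => Function.update x i t) ⁻¹' E).indicator 1 t := fun t => rfl
  simp only [h1]
  rw [lintegral_indicator_one (hup hEm)]
  by_contra hcon
  push Not at hcon
  obtain ⟨p, hp, hev, hco⟩ := gT_step D c hc S T i hi x
  have hv := hcon.trans_le (gauss_le_volume _)
  have hne : ((fun t : ℝ => Function.update x i t) ⁻¹' E).Nonempty := by
    by_contra h
    rw [Set.not_nonempty_iff_eq_empty] at h
    simp [h] at hv
  obtain ⟨t0, -, ht0, -⟩ := hne
  rw [gT_update] at ht0
  have := coef_bound n hn' D p ((2 * (4 * (n:ℝ) ^ 2) ^ D)⁻¹ * A) _ hp (fun t ht => by simpa using ht.1)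
    (fun t ht => by rw [hev]; exact ht.2.2) hv (S.count i)
  rw [hco] at this
  have hK : (0:ℝ) < (4 * (n:ℝ) ^ 2) ^ D := by positivity
  have e : (2 * (4 * (n:ℝ) ^ 2) ^ D)⁻¹ * A * (4 * (n:ℝ) ^ 2) ^ D = A / 2 := by
    field_simp
  rw [e] at this
  linarith

theorem multi_step {n : ℕ} (hn : 2 ≤ n) (D : ℕ) (c : Multiset (Fin n) →₀ ℝ)
    (hc : ∀ S ∈ c.support, Multiset.card S ≤ D)
    (S : Multiset (Fin n)) (T : Finset (Fin n)) : ∀ (A : ℝ) (_ : 0 < A),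
    (Measure.pi fun _ : Fin n => gaussianReal 0 1)
      {y | (∀ i, |y i| ≤ n) ∧ A ≤ |gT c S T y| ∧
        |gT c S ∅ y| < (2 * (4 * (n:ℝ) ^ 2) ^ D)⁻¹ ^ T.card * A} ≤
      ENNReal.ofReal (T.card * (D * (2 / n))) := by
  induction T using Finset.induction_on with
  | empty =>
    intro A hA
    have : {y : Fin n → ℝ | (∀ i, |y i| ≤ n) ∧ A ≤ |gT c S ∅ y| ∧
        |gT c S ∅ y| < (2 * (4 * (n:ℝ) ^ 2) ^ D)⁻¹ ^ (∅ : Finset (Fin n)).card * A} = ∅ := by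
      ext y
      simp only [Finset.card_empty, pow_zero, one_mul, Set.mem_ofPred_eq, Set.mem_empty_iff_false,
        iff_false]
      rintro ⟨_, h1, h2⟩
      linarith
    rw [this]
    simp
  | insert i T hi ih =>
    intro A hA
    set κ := (2 * (4 * (n:ℝ) ^ 2) ^ D)⁻¹ with hκ
    have hκ0 : 0 < κ := by positivity
    have h1 := step_measure hn D c hc S T i hi A hA
    have h2 := ih (κ * A) (by positivity)
    have h3 := add_le_add h1 h2
    rw [← ENNReal.ofReal_add (by positivity) (by positivity)] at h3
    refine ((measure_mono ?_).trans (measure_union_le _ _)).trans (h3.trans ?_)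
    · rintro y ⟨hy, hy1, hy2⟩
      rw [Finset.card_insert_of_notMem hi] at hy2
      by_cases h : |gT c S T y| ≤ κ * A
      · exact Or.inl ⟨hy i, hy1, h⟩
      · refine Or.inr ⟨hy, (not_le.1 h).le, ?_⟩
        rwa [← mul_assoc, ← pow_succ]
    · apply ENNReal.ofReal_le_ofReal
      rw [Finset.card_insert_of_notMem hi]
      push_cast
      apply le_of_eq; ring

theorem lower_bound {n : ℕ} (hn : 2 ≤ n) (D : ℕ) (hD : 1 ≤ D) (c : Multiset (Fin n) →₀ ℝ)
    (hc : ∀ S ∈ c.support, Multiset.card S ≤ D) (S : Multiset (Fin n)) (hS : S ∈ c.support)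
    (hmax : ∀ R ∈ c.support, R ≠ 0 → |c R| * (2 * D * (n:ℝ) ^ 2) ^ Multiset.card R ≤
      |c S| * (2 * D * (n:ℝ) ^ 2) ^ Multiset.card S)
    (y : Fin n → ℝ) (hy : ∀ i, |y i| ≤ n) : |c S| / 2 ≤ |gT c S S.toFinset y| := by
  have hn' : (2:ℝ) ≤ n := by exact_mod_cast hn
  have hD' : (1:ℝ) ≤ D := by exact_mod_cast hD
  have hn0 : (0:ℝ) < n := by linarith
  have hn1 : (1:ℝ) ≤ n := by linarith
  have hD0 : (0:ℝ) < D := by linarith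
  set B := 2 * D * (n:ℝ) ^ 2 with hB
  have hB0 : 0 < B := by positivity
  unfold gT
  set F := c.support.filter (fun R => ∀ j ∈ S.toFinset, R.count j = S.count j) with hF
  have hSF : S ∈ F := Finset.mem_filter.2 ⟨hS, fun _ _ => rfl⟩
  rw [← Finset.add_sum_erase _ _ hSF]
  have e1 : ∏ j ∈ S.toFinsetᶜ, y j ^ S.count j = 1 := by
    apply Finset.prod_eq_one
    intro j hj
    rw [Multiset.count_eq_zero_of_notMem (by simpa using hj), pow_zero]
  rw [e1, mul_one]
  have hle : ∀ R ∈ F.erase S, S ≤ R := by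
    intro R hR
    have h2 := (Finset.mem_filter.1 (Finset.mem_of_mem_erase hR)).2
    rw [Multiset.le_iff_count]
    intro j
    by_cases hj : j ∈ S
    · exact (h2 j (by simpa using hj)).ge
    · rw [Multiset.count_eq_zero_of_notMem hj]; exact Nat.zero_le _
  have hQ0 : ∀ R ∈ F.erase S, 1 ≤ Multiset.card (R - S) := by
    intro R hR
    rw [Nat.one_le_iff_ne_zero, Ne, Multiset.card_eq_zero]
    intro h
    have := tsub_add_cancel_of_le (hle R hR)
    rw [h, zero_add] at this
    exact (Finset.ne_of_mem_erase hR) this.symm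
  have hterm : ∀ R ∈ F.erase S, |c R * ∏ j ∈ S.toFinsetᶜ, y j ^ R.count j| ≤
      |c S| / (2 * D) * ((n:ℝ) ^ Multiset.card (R - S))⁻¹ := by
    intro R hR
    have h1 := (Finset.mem_filter.1 (Finset.mem_of_mem_erase hR)).1
    have hSR := hle R hR
    have hq := hQ0 R hR
    set Q := R - S with hQ
    have hRQ : R = Q + S := (tsub_add_cancel_of_le hSR).symm
    have hcard : Multiset.card R = Multiset.card Q + Multiset.card S := by
      rw [hRQ, Multiset.card_add]
    have hR0 : R ≠ 0 := by
      rintro rfl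
      simp at hcard
      omega
    have hm := hmax R h1 hR0
    rw [hcard, pow_add, ← mul_assoc] at hm
    have hm2 : |c R| * B ^ Multiset.card Q ≤ |c S| := le_of_mul_le_mul_right hm (by positivity)
    have hp : |∏ j ∈ S.toFinsetᶜ, y j ^ R.count j| ≤ (n:ℝ) ^ Multiset.card Q := by
      rw [Finset.abs_prod]
      calc _ ≤ ∏ j ∈ S.toFinsetᶜ, (n:ℝ) ^ Q.count j := by
            apply Finset.prod_le_prod (fun _ _ => abs_nonneg _)
            intro j hj
            have : R.count j = Q.count j := by
              rw [hRQ, Multiset.count_add, Multiset.count_eq_zero_of_notMem (s := S) (by simpa using hj), add_zero]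
            rw [this, abs_pow]
            exact pow_le_pow_left₀ (abs_nonneg _) (hy j) _
        _ = (n:ℝ) ^ (∑ j ∈ S.toFinsetᶜ, Q.count j) := by rw [Finset.prod_pow_eq_pow_sum]
        _ ≤ _ := by
            apply pow_le_pow_right₀ hn1
            rw [← Multiset.sum_count_eq_card (s := Finset.univ) (m := Q) (fun a _ => Finset.mem_univ a)]
            exact Finset.sum_le_sum_of_subset (Finset.subset_univ _)
    set q := Multiset.card Q
    have hBq : 2 * D * (n:ℝ) ^ q * (n:ℝ) ^ q ≤ B ^ q := by
      rw [hB, mul_pow, ← pow_mul, mul_assoc, ← pow_add, two_mul q]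
      exact mul_le_mul_of_nonneg_right (le_self_pow₀ (by linarith) (by omega)) (by positivity)
    rw [abs_mul, ← div_eq_mul_inv, div_div, le_div_iff₀ (by positivity)]
    calc _ ≤ |c R| * (n:ℝ) ^ q * (2 * D * (n:ℝ) ^ q) := by gcongr
      _ = |c R| * (2 * D * (n:ℝ) ^ q * (n:ℝ) ^ q) := by ring
      _ ≤ |c R| * B ^ q := by gcongr
      _ ≤ _ := hm2
  have hsum : |∑ R ∈ F.erase S, c R * ∏ j ∈ S.toFinsetᶜ, y j ^ R.count j| ≤ |c S| / 2 := by
    refine (Finset.abs_sum_le_sum_abs _ _).trans ((Finset.sum_le_sum hterm).trans ?_)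
    rw [← Finset.mul_sum]
    have hinj : Set.InjOn (fun R : Multiset (Fin n) => R - S) (F.erase S : Set (Multiset (Fin n))) := by
      intro R hR R' hR' h
      have a := tsub_add_cancel_of_le (hle R hR)
      have b := tsub_add_cancel_of_le (hle R' hR')
      simp only at h
      rw [← a, ← b, h]
    have := count_sum hn D ((F.erase S).image (fun R => R - S)) (by
      intro Q hQ
      obtain ⟨R, hR, rfl⟩ := Finset.mem_image.1 hQ
      refine ⟨hQ0 R hR, ?_⟩
      exact (Multiset.card_le_card (Multiset.sub_le_self R S)).trans (hc R (Finset.mem_filter.1 (Finset.mem_of_mem_erase hR)).1))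
    rw [Finset.sum_image hinj] at this
    calc _ ≤ |c S| / (2 * D) * D := by gcongr
      _ = _ := by field_simp
  have := abs_sub_abs_le_abs_add (c S) (∑ R ∈ F.erase S, c R * ∏ j ∈ S.toFinsetᶜ, y j ^ R.count j)
  linarith

theorem upper_bound {n : ℕ} (hn : 2 ≤ n) (D : ℕ) (hD : 1 ≤ D) (c : Multiset (Fin n) →₀ ℝ)
    (hc : ∀ S ∈ c.support, Multiset.card S ≤ D) (S : Multiset (Fin n)) (hS : S ∈ c.support)
    (hmax : ∀ R ∈ c.support, R ≠ 0 → |c R| * (2 * D * (n:ℝ) ^ 2) ^ Multiset.card R ≤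
      |c S| * (2 * D * (n:ℝ) ^ 2) ^ Multiset.card S)
    (C δ : ℝ) (hC : 0 < C) (hδ0 : 0 ≤ δ) (hδ : δ ≤ C)
    (y z : Fin n → ℝ) (hy : ∀ i, |y i| ≤ n) (hyz : ∀ i, |y i - z i| ≤ δ) :
    |polyEval c y - polyEval c z| ≤
      |c S| * (2 * D * (n:ℝ) ^ 2) ^ D * (D * (1 + C) ^ D * δ) * D := by
  have hn' : (2:ℝ) ≤ n := by exact_mod_cast hn
  have hD' : (1:ℝ) ≤ D := by exact_mod_cast hD
  have hn0 : (0:ℝ) < n := by linarith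
  have hn1 : (1:ℝ) ≤ n := by linarith
  have hD0 : (0:ℝ) < D := by linarith
  set B := 2 * D * (n:ℝ) ^ 2 with hB
  have hB0 : 0 < B := by positivity
  have hB1 : 1 ≤ B := by rw [hB]; nlinarith
  unfold polyEval
  rw [← Finset.sum_sub_distrib]
  have e : ∑ R ∈ c.support, (c R * (R.map y).prod - c R * (R.map z).prod) =
      ∑ R ∈ c.support.erase 0, c R * ((R.map y).prod - (R.map z).prod) := by
    simp only [← mul_sub]
    symm
    apply Finset.sum_subset (Finset.erase_subset _ _)
    intro R hR hR'
    have : R = 0 := by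
      by_contra h
      exact hR' (Finset.mem_erase.2 ⟨h, hR⟩)
    simp [this]
  rw [e]
  set M := (1 + C) * (n:ℝ) with hM
  have hM1 : 1 ≤ M := by nlinarith
  have hyM : ∀ i, |y i| ≤ M := fun i => (hy i).trans (by nlinarith)
  have hzM : ∀ i, |z i| ≤ M := fun i => by
    have h1 : |z i| ≤ |y i| + |y i - z i| := by
      have := abs_sub_abs_le_abs_sub (z i) (y i)
      rw [abs_sub_comm] at this
      linarith
    have := hy i
    have := hyz i
    nlinarith
  have hterm : ∀ R ∈ c.support.erase 0, |c R * ((R.map y).prod - (R.map z).prod)| ≤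
      |c S| * B ^ D * (D * (1 + C) ^ D * δ) * ((n:ℝ) ^ Multiset.card R)⁻¹ := by
    intro R hR
    have hR0 := Finset.ne_of_mem_erase hR
    have hRs := Finset.mem_of_mem_erase hR
    have hm := hmax R hRs hR0
    have hb := (prod_bound M δ hM1 y z hδ0 hyM hzM hyz R).2
    have hrD := hc R hRs
    set r := Multiset.card R with hr
    have hSD : B ^ Multiset.card S ≤ B ^ D := pow_le_pow_right₀ hB1 (hc S hS)
    have hBr : (n:ℝ) ^ r * (n:ℝ) ^ r ≤ B ^ r := by
      rw [hB, mul_pow, ← pow_mul, ← pow_add, two_mul r]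
      exact le_mul_of_one_le_left (by positivity) (one_le_pow₀ (by linarith))
    have hb2 : (r:ℝ) * M ^ r * δ ≤ (D * (1 + C) ^ D * δ) * (n:ℝ) ^ r := by
      rw [hM, mul_pow]
      have h1 : (r:ℝ) ≤ D := by exact_mod_cast hrD
      have h2 : (1 + C) ^ r ≤ (1 + C) ^ D := pow_le_pow_right₀ (by linarith) hrD
      calc _ ≤ (D:ℝ) * ((1 + C) ^ D * (n:ℝ) ^ r) * δ := by gcongr
        _ = _ := by ring
    rw [abs_mul, ← div_eq_mul_inv, le_div_iff₀ (by positivity)]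
    set L := D * (1 + C) ^ D * δ with hL
    have hL0 : 0 ≤ L := by positivity
    calc _ ≤ |c R| * (L * (n:ℝ) ^ r) * (n:ℝ) ^ r := by
          gcongr
          exact hb.trans hb2
      _ = |c R| * ((n:ℝ) ^ r * (n:ℝ) ^ r) * L := by ring
      _ ≤ |c R| * B ^ r * L := by gcongr
      _ ≤ |c S| * B ^ Multiset.card S * L := by gcongr
      _ ≤ _ := by gcongr
  refine (Finset.abs_sum_le_sum_abs _ _).trans ((Finset.sum_le_sum hterm).trans ?_)
  rw [← Finset.mul_sum]
  have := count_sum hn D (c.support.erase 0) (fun R hR => ⟨by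
    rw [Nat.one_le_iff_ne_zero, Ne, Multiset.card_eq_zero]; exact Finset.ne_of_mem_erase hR,
    hc R (Finset.mem_of_mem_erase hR)⟩)
  gcongr

theorem sign_ne {a b : ℝ} (h : Real.sign a ≠ Real.sign b) : |a| ≤ |a - b| := by
  by_contra hcon
  push Not at hcon
  apply h
  rcases lt_trichotomy a 0 with ha | ha | ha
  · have hb : b < 0 := by
      by_contra hb
      rw [abs_of_neg ha, abs_of_nonpos (by linarith)] at hcon
      linarith
    rw [Real.sign_of_neg ha, Real.sign_of_neg hb]
  · subst ha
    simp at hcon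
    exact absurd hcon (not_lt.2 (abs_nonneg _))
  · have hb : 0 < b := by
      by_contra hb
      rw [abs_of_pos ha, abs_of_nonneg (by linarith)] at hcon
      linarith
    rw [Real.sign_of_pos ha, Real.sign_of_pos hb]

theorem eta_eq (n D : ℕ) : ((n ^ (24 * D ^ 2) : ℕ) : ℝ) ^ (-(1 / 4 : ℝ)) = ((n : ℝ) ^ (6 * D ^ 2))⁻¹ := by
  have h : ((n ^ (24 * D ^ 2) : ℕ) : ℝ) = ((n : ℝ) ^ (6 * D ^ 2)) ^ 4 := by
    push_cast
    rw [← pow_mul]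
    congr 1
    ring
  rw [h, Real.rpow_neg (by positivity)]
  congr 1
  have := Real.pow_rpow_inv_natCast (x := (n : ℝ) ^ (6 * D ^ 2)) (n := 4) (by positivity) (by norm_num)
  rw [one_div]
  exact_mod_cast this

theorem numeric (D : ℕ) (hD : 1 ≤ D) (C : ℝ) (hC : 0 < C) (n : ℕ) (hn : 2 ≤ n)
    (hG : (2 * D : ℝ) ^ D * D ^ 2 * (1 + C) ^ D * C * 2 ^ (D + 1) * (4 ^ D) ^ D < n) (a : ℝ) (ha : 0 < a)
    (m : ℕ) (hm : m ≤ D) :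
    a * (2 * D * (n:ℝ) ^ 2) ^ D * (D * (1 + C) ^ D * (C * ((n : ℝ) ^ (6 * D ^ 2))⁻¹)) * D <
      (2 * (4 * (n:ℝ) ^ 2) ^ D)⁻¹ ^ m * (a / 2) := by
  have hn' : (2:ℝ) ≤ n := by exact_mod_cast hn
  have hD' : (1:ℝ) ≤ D := by exact_mod_cast hD
  have hn0 : (0:ℝ) < n := by linarith
  have hn1 : (1:ℝ) ≤ n := by linarith
  have h1 : (2 * (4 * (n:ℝ) ^ 2) ^ D)⁻¹ ^ D ≤ (2 * (4 * (n:ℝ) ^ 2) ^ D)⁻¹ ^ m := by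
    apply pow_le_pow_of_le_one (by positivity) _ hm
    apply inv_le_one_of_one_le₀
    have : (1:ℝ) ≤ (4 * (n:ℝ) ^ 2) ^ D := one_le_pow₀ (by nlinarith)
    linarith
  refine lt_of_lt_of_le ?_ (mul_le_mul_of_nonneg_right h1 (by positivity))
  have e1 : (2 * (4 * (n:ℝ) ^ 2) ^ D)⁻¹ ^ D * (a / 2) =
      a / (2 ^ (D + 1) * (4 ^ D) ^ D * (n:ℝ) ^ (2 * D * D)) := by
    have e0 : (2 * (4 * (n:ℝ) ^ 2) ^ D) ^ D * 2 = 2 ^ (D + 1) * (4 ^ D) ^ D * (n:ℝ) ^ (2 * D * D) := by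
      rw [mul_pow, mul_pow 4, mul_pow, ← pow_mul (n:ℝ), ← pow_mul (n:ℝ), pow_succ]
      ring
    rw [← e0, inv_pow]
    field_simp
  have e2 : a * (2 * D * (n:ℝ) ^ 2) ^ D * (D * (1 + C) ^ D * (C * ((n : ℝ) ^ (6 * D ^ 2))⁻¹)) * D =
      a * ((2 * D : ℝ) ^ D * D ^ 2 * (1 + C) ^ D * C * (n:ℝ) ^ (2 * D)) / (n : ℝ) ^ (6 * D ^ 2) := by
    rw [mul_pow (2 * (D:ℝ)), ← pow_mul]
    field_simp
  rw [e1, e2, div_lt_div_iff₀ (by positivity) (by positivity), mul_assoc]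
  apply mul_lt_mul_of_pos_left _ ha
  calc _ = ((2 * D : ℝ) ^ D * D ^ 2 * (1 + C) ^ D * C * 2 ^ (D + 1) * (4 ^ D) ^ D) * (n:ℝ) ^ (2 * D + 2 * D * D) := by
        rw [pow_add]; ring
    _ < n * (n:ℝ) ^ (2 * D + 2 * D * D) := by gcongr
    _ = (n:ℝ) ^ (2 * D + 2 * D * D + 1) := by ring
    _ ≤ (n:ℝ) ^ (6 * D ^ 2) := by
        apply pow_le_pow_right₀ hn1
        nlinarith

/-- Theorem 3.10 (discretization): fix `D ≥ 1` and `C > 0`. There is `C' > 0`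
such that for all `n ≥ 2`, with `N = n^{24D²}`, if `ν` is a coupling on `ℝ²` of
the standard Gaussian and a scaled sum of `N` signs with
`Pr[|y_i - z_i| ≤ C·N^{-1/4}] ≥ 1 - C·N^{-1/4}`, and `(y, z)` has i.i.d.
coordinate pairs drawn from `ν`, then every nonconstant degree-`D` polynomial
`f` satisfies `Pr[sgn(f(y)) ≠ sgn(f(z))] ≤ C'/n`. -/
theorem stmt11 (D : ℕ) (hD : 1 ≤ D) (C : ℝ) (hC : 0 < C) :
    ∃ C' : ℝ, 0 < C' ∧ ∀ n : ℕ, 2 ≤ n →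
      ∀ ν : Measure (ℝ × ℝ), IsProbabilityMeasure ν →
        ν.map Prod.fst = gaussianReal 0 1 →
        ν.map Prod.snd = scaledSumSigns (n ^ (24 * D ^ 2)) →
        ENNReal.ofReal (1 - C * ((n ^ (24 * D ^ 2) : ℕ) : ℝ) ^ (-(1 / 4 : ℝ))) ≤
          ν {p | |p.1 - p.2| ≤ C * ((n ^ (24 * D ^ 2) : ℕ) : ℝ) ^ (-(1 / 4 : ℝ))} →
        ∀ c : Multiset (Fin n) →₀ ℝ,
          (∀ S ∈ c.support, Multiset.card S ≤ D) →
          (∃ S ∈ c.support, S ≠ 0) →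
          (Measure.pi fun _ : Fin n => ν)
              {ω | Real.sign (polyEval c fun i => (ω i).1) ≠
                Real.sign (polyEval c fun i => (ω i).2)} ≤
            ENNReal.ofReal (C' / n) := by
  set G : ℝ := (2 * D : ℝ) ^ D * D ^ 2 * (1 + C) ^ D * C * 2 ^ (D + 1) * (4 ^ D) ^ D with hGdef
  have hG0 : 0 ≤ G := by positivity
  refine ⟨G + 2 * D ^ 2 + C + 1, by positivity, ?_⟩
  intro n hn ν hν hfst _ hclose c hc hnc
  have hn' : (2:ℝ) ≤ n := by exact_mod_cast hn
  have hn0 : (0:ℝ) < n := by linarith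
  have hn1 : (1:ℝ) ≤ n := by linarith
  have hD' : (1:ℝ) ≤ D := by exact_mod_cast hD
  rcases le_or_gt (n : ℝ) G with hG | hG
  · refine prob_le_one.trans ?_
    rw [ENNReal.one_le_ofReal, le_div_iff₀ hn0]
    nlinarith
  rw [eta_eq] at hclose
  set δ := C * ((n : ℝ) ^ (6 * D ^ 2))⁻¹ with hδ
  have hδ0 : 0 ≤ δ := by positivity
  have hη : δ ≤ C * ((n:ℝ) ^ 2)⁻¹ := by
    rw [hδ]
    have : 2 ≤ 6 * D ^ 2 := by nlinarith
    gcongr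
  have hδC : δ ≤ C := by
    refine hη.trans (mul_le_of_le_one_right hC.le ?_)
    exact inv_le_one_of_one_le₀ (one_le_pow₀ hn1)
  -- the maximal monomial
  obtain ⟨S, hS, hmax⟩ := Finset.exists_max_image (c.support.erase 0)
    (fun R => |c R| * (2 * D * (n:ℝ) ^ 2) ^ Multiset.card R)
    (by obtain ⟨S, hS, hS0⟩ := hnc; exact ⟨S, Finset.mem_erase.2 ⟨hS0, hS⟩⟩)
  have hSs := Finset.mem_of_mem_erase hS
  have hmax' : ∀ R ∈ c.support, R ≠ 0 → |c R| * (2 * D * (n:ℝ) ^ 2) ^ Multiset.card R ≤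
      |c S| * (2 * D * (n:ℝ) ^ 2) ^ Multiset.card S :=
    fun R hR hR0 => hmax R (Finset.mem_erase.2 ⟨hR0, hR⟩)
  have hcS : 0 < |c S| := abs_pos.2 (Finsupp.mem_support_iff.1 hSs)
  have hTD : S.toFinset.card ≤ D := (Multiset.toFinset_card_le S).trans (hc S hSs)
  set P := Measure.pi fun _ : Fin n => ν with hP
  -- coordinatewise bad events
  have hev : ∀ (i : Fin n) (s : Set (ℝ × ℝ)), P {ω | ω i ∈ s} ≤ ν s := by
    intro i s
    have h := Measure.le_map_apply (μ := P) (f := Function.eval i) (measurable_pi_apply i).aemeasurable s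
    rwa [(measurePreserving_eval (fun _ : Fin n => ν) i).map_eq] at h
  have b1 : P (⋃ i, {ω | ω i ∈ {p : ℝ × ℝ | (n:ℝ) < |p.1|}}) ≤ ENNReal.ofReal (1 / n) := by
    refine (measure_iUnion_fintype_le _ _).trans ?_
    have : ∀ i ∈ (Finset.univ : Finset (Fin n)), P {ω | ω i ∈ {p : ℝ × ℝ | (n:ℝ) < |p.1|}} ≤ ENNReal.ofReal (1 / (n:ℝ) ^ 2) := by
      intro i _
      refine (hev i _).trans ?_
      have h := Measure.le_map_apply (μ := ν) (f := Prod.fst) measurable_fst.aemeasurable {t : ℝ | (n:ℝ) < |t|}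
      rw [hfst] at h
      exact h.trans (gauss_tail n hn')
    refine (Finset.sum_le_sum this).trans ?_
    rw [Finset.sum_const, Finset.card_univ, Fintype.card_fin, ← ENNReal.ofReal_nsmul]
    apply ENNReal.ofReal_le_ofReal
    rw [nsmul_eq_mul]
    apply le_of_eq
    field_simp
  have hνbad : ν {p : ℝ × ℝ | |p.1 - p.2| ≤ δ}ᶜ ≤ ENNReal.ofReal δ := by
    have hm : MeasurableSet {p : ℝ × ℝ | |p.1 - p.2| ≤ δ} :=
      measurableSet_le (f := fun p : ℝ × ℝ => |p.1 - p.2|) (by fun_prop) measurable_const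
    rw [prob_compl_eq_one_sub hm, tsub_le_iff_right]
    refine le_trans ?_ (add_le_add_right hclose _)
    refine le_trans ?_ ENNReal.ofReal_add_le
    simp
  have b2 : P (⋃ i, {ω | ω i ∈ {p : ℝ × ℝ | |p.1 - p.2| ≤ δ}ᶜ}) ≤ ENNReal.ofReal (C / n) := by
    refine (measure_iUnion_fintype_le _ _).trans ?_
    refine (Finset.sum_le_sum (fun i _ => (hev i _).trans hνbad)).trans ?_
    rw [Finset.sum_const, Finset.card_univ, Fintype.card_fin, ← ENNReal.ofReal_nsmul]
    apply ENNReal.ofReal_le_ofReal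
    rw [nsmul_eq_mul]
    calc (n:ℝ) * δ ≤ n * (C * ((n:ℝ) ^ 2)⁻¹) := by gcongr
      _ = C / n := by field_simp
  have hms := multi_step hn D c hc S S.toFinset (|c S| / 2) (by positivity)
  set W := {y : Fin n → ℝ | (∀ i, |y i| ≤ n) ∧ |c S| / 2 ≤ |gT c S S.toFinset y| ∧
        |gT c S ∅ y| < (2 * (4 * (n:ℝ) ^ 2) ^ D)⁻¹ ^ S.toFinset.card * (|c S| / 2)} with hW
  have b3 : P ((fun ω i => (ω i).1) ⁻¹' W) ≤ ENNReal.ofReal (2 * D ^ 2 / n) := by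
    have h := Measure.le_map_apply (μ := P) (f := fun (ω : Fin n → ℝ × ℝ) i => (ω i).1)
      (by
        refine Measurable.aemeasurable ?_
        fun_prop) W
    have hmp : MeasurePreserving (fun (ω : Fin n → ℝ × ℝ) i => (ω i).1) P
        (Measure.pi fun _ : Fin n => gaussianReal 0 1) :=
      measurePreserving_pi (fun _ : Fin n => ν) (fun _ : Fin n => gaussianReal 0 1)
        (f := fun _ => Prod.fst) (fun _ => ⟨measurable_fst, hfst⟩)
    rw [hmp.map_eq] at h
    refine h.trans (hms.trans (ENNReal.ofReal_le_ofReal ?_))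
    have : (S.toFinset.card : ℝ) ≤ D := by exact_mod_cast hTD
    calc _ ≤ (D:ℝ) * (D * (2 / n)) := by gcongr
      _ = _ := by ring
  have hsub : {ω : Fin n → ℝ × ℝ | Real.sign (polyEval c fun i => (ω i).1) ≠
                Real.sign (polyEval c fun i => (ω i).2)} ⊆
      ((⋃ i, {ω | ω i ∈ {p : ℝ × ℝ | (n:ℝ) < |p.1|}}) ∪ (⋃ i, {ω | ω i ∈ {p : ℝ × ℝ | |p.1 - p.2| ≤ δ}ᶜ})) ∪
      ((fun ω i => (ω i).1) ⁻¹' W) := by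
    intro ω hω
    by_cases h1 : ∀ i, |(ω i).1| ≤ n
    swap
    · push Not at h1
      obtain ⟨i, hi⟩ := h1
      exact Or.inl (Or.inl (Set.mem_iUnion.2 ⟨i, hi⟩))
    by_cases h2 : ∀ i, |(ω i).1 - (ω i).2| ≤ δ
    swap
    · rw [not_forall] at h2
      obtain ⟨i, hi⟩ := h2
      exact Or.inl (Or.inr (Set.mem_iUnion.2 ⟨i, hi⟩))
    refine Or.inr ⟨h1, lower_bound hn D hD c hc S hSs hmax' _ h1, ?_⟩
    rw [gT_empty]
    refine (sign_ne hω).trans_lt ?_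
    refine (upper_bound hn D hD c hc S hSs hmax' C δ hC hδ0 hδC _ _ h1 h2).trans_lt ?_
    exact numeric D hD C hC n hn hG _ hcS _ hTD
  refine (measure_mono hsub).trans ((measure_union_le _ _).trans ?_)
  refine (add_le_add ((measure_union_le _ _).trans (add_le_add b1 b2)) b3).trans ?_
  rw [← ENNReal.ofReal_add (by positivity) (by positivity),
    ← ENNReal.ofReal_add (by positivity) (by positivity)]
  apply ENNReal.ofReal_le_ofReal
  rw [← add_div, ← add_div]
  apply div_le_div_of_nonneg_right _ hn0.le
  linarith
end

section
/- For all sufficiently large n the following holds. Let f(x) = θ + Σ_{i∈[n]} c_i x_i + Σ_{i,j∈[n], i≤j} c_{ij} x_i x_j be a degree-2 polynomial on ℝ^n, set A = Σ_{i=1}^n c_i and I(f) = {i ∈ [n] : c_i > A/n²}, and set β = 1/log n. If f passes the dictator test T_2 with probability at least 1/2 + β, then |I(f)| ≤ 1/β² and A > 0. -/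
open MeasureTheory ProbabilityTheory Real
open scoped ENNReal NNReal

/-- Bernoulli measure on `Bool` with `Pr[true] = p`. -/
noncomputable def bernoulliBool (p : ℝ) : Measure Bool :=
  ENNReal.ofReal p • Measure.dirac true + ENNReal.ofReal (1 - p) • Measure.dirac false

/-- Product of `n` independent standard Gaussians. -/
noncomputable def stdGaussianPi (n : ℕ) : Measure (Fin n → ℝ) :=
  Measure.pi fun _ => gaussianReal 0 1

/-- The uniform probability measure on a finite set. -/
noncomputable def uniformFinset {α : Type*} [MeasurableSpace α] (s : Finset α) : Measure α :=
  (s.card : ℝ≥0∞)⁻¹ • ∑ a ∈ s, Measure.dirac a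

/-- The sample distribution of the dictator test `T₂`: `n` independent
Bernoulli(β) bits `a` with `β = 1/log n`, `n` i.i.d. standard Gaussians `g`, a
uniform exponent `i ∈ {1, …, (log n)²}`, and a uniform sign `b ∈ {-1, 1}`. -/
noncomputable def T2Measure (n : ℕ) :
    Measure ((Fin n → Bool) × (Fin n → ℝ) × ℕ × ℝ) :=
  (Measure.pi fun _ : Fin n => bernoulliBool (1 / Real.log n)).prod
    ((stdGaussianPi n).prod
      ((uniformFinset (Finset.Icc 1 ⌊(Real.log n) ^ 2⌋₊)).prod signUnif))

/-- The query point `y = t³ r + b t² δ ω` of the dictator test `T₂`, where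
`r = (a₁ g₁, …, aₙ gₙ)`, `t = n^i`, `δ = 2^{-n}` and `ω = (1, …, 1)`. -/
noncomputable def T2Point (n : ℕ) (ω : (Fin n → Bool) × (Fin n → ℝ) × ℕ × ℝ) :
    Fin n → ℝ :=
  fun j => ((n : ℝ) ^ ω.2.2.1) ^ 3 * (if ω.1 j then ω.2.1 j else 0)
    + ω.2.2.2 * ((n : ℝ) ^ ω.2.2.1) ^ 2 * (2 : ℝ) ^ (-(n : ℤ))


/-- The value of the polynomial along the test curve. -/
noncomputable def tval (c : Fin 6 → ℝ) (t b : ℝ) : ℝ :=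
  c 0 + c 2 * t ^ 3 + c 3 * t ^ 4 + c 5 * t ^ 6 + b * (c 1 * t ^ 2 + c 4 * t ^ 5)

def eexp : Fin 6 → ℕ := ![0, 2, 3, 4, 5, 6]

/-- number of signs on which the test passes -/
noncomputable def scount (c : Fin 6 → ℝ) (t : ℝ) : ℕ :=
  (if 0 < tval c t 1 then 1 else 0) + (if tval c t (-1) < 0 then 1 else 0)

/-- flip of the odd coefficients -/
def cflip (c : Fin 6 → ℝ) : Fin 6 → ℝ := ![c 0, c 1, - c 2, c 3, - c 4, c 5]

def badPair (c : Fin 6 → ℝ) (t : ℝ) (p q : Fin 6) : Prop :=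
  |c p * t ^ eexp p| < 6 * |c q * t ^ eexp q| ∧ |c q * t ^ eexp q| < 6 * |c p * t ^ eexp p|

lemma eexp_strictMono : StrictMono eexp := by
  intro p q h
  revert p q
  decide

lemma dominate (c : Fin 6 → ℝ) (t : ℝ) (h : ∀ p q, p < q → ¬ badPair c t p q) :
    ∃ p, ∀ q, q ≠ p → 6 * |c q * t ^ eexp q| ≤ |c p * t ^ eexp p| := by
  obtain ⟨p, hp⟩ := Finite.exists_max (fun p : Fin 6 => |c p * t ^ eexp p|)
  refine ⟨p, fun q hq => ?_⟩
  have h1 := hp q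
  have h2 := abs_nonneg (c q * t ^ eexp q)
  have key : ¬ badPair c t p q := by
    rcases lt_or_gt_of_ne hq with hlt | hlt
    · intro hb
      exact h q p hlt ⟨hb.2, hb.1⟩
    · exact h p q hlt
  unfold badPair at key
  by_contra hcon
  push Not at hcon
  exact key ⟨hcon, by linarith⟩

set_option maxHeartbeats 1000000 in
lemma scount_good (c : Fin 6 → ℝ) (t : ℝ) (ht : 1 ≤ t)
    (h : ∀ p q, p < q → ¬ badPair c t p q) :
    scount c t + scount (cflip c) t ≤ 2 ∨ (0 < c 1 ∧ |c 2| ≤ c 1) := by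
  obtain ⟨p, hp⟩ := dominate c t h
  by_cases hA : p = 1 ∧ 0 < c 1
  · right
    obtain ⟨rfl, hA⟩ := hA
    refine ⟨hA, ?_⟩
    have := hp 2 (by decide)
    simp only [eexp, Fin.isValue, Matrix.cons_val] at this
    rw [abs_mul, abs_mul, abs_of_pos hA, abs_of_pos (by positivity : 0 < t ^ 3),
      abs_of_pos (by positivity : 0 < t ^ 2)] at this
    have h3 : |c 2| * t ^ 2 ≤ |c 2| * t ^ 3 :=
      mul_le_mul_of_nonneg_left (pow_le_pow_right₀ ht (by norm_num)) (abs_nonneg _)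
    have h4 : |c 2| * t ^ 2 ≤ c 1 * t ^ 2 := by
      nlinarith [mul_nonneg (abs_nonneg (c 2)) (by positivity : 0 ≤ t ^ 3)]
    exact le_of_mul_le_mul_right h4 (by positivity)
  · left
    have h0 := hp 0
    have h1 := hp 1
    have h2 := hp 2
    have h3 := hp 3
    have h4 := hp 4
    have h5 := hp 5
    have hA' : p = 1 → c 1 * t ^ 2 ≤ 0 := by
      intro hp1
      have : c 1 ≤ 0 := by
        by_contra hc
        exact hA ⟨hp1, by linarith⟩
      exact mul_nonpos_of_nonpos_of_nonneg this (by positivity)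
    clear hp h hA
    have key : ∀ m0 m1 m2 m3 m4 m5 M : ℝ,
        (p = 0 → M = |m0|) → (p = 1 → M = |m1|) → (p = 2 → M = |m2|) → (p = 3 → M = |m3|) →
        (p = 4 → M = |m4|) → (p = 5 → M = |m5|) →
        (0 ≠ p → 6 * |m0| ≤ M) → (1 ≠ p → 6 * |m1| ≤ M) → (2 ≠ p → 6 * |m2| ≤ M) →
        (3 ≠ p → 6 * |m3| ≤ M) → (4 ≠ p → 6 * |m4| ≤ M) → (5 ≠ p → 6 * |m5| ≤ M) →
        (p = 1 → m1 ≤ 0) →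
        ((if 0 < m0 + m2 + m3 + m5 + 1 * (m1 + m4) then 1 else 0) +
          (if m0 + m2 + m3 + m5 + -1 * (m1 + m4) < 0 then 1 else 0)) +
        ((if 0 < m0 + -m2 + m3 + m5 + 1 * (m1 + -m4) then 1 else 0) +
          (if m0 + -m2 + m3 + m5 + -1 * (m1 + -m4) < 0 then 1 else 0)) ≤ 2 := by
      clear h0 h1 h2 h3 h4 h5 hA'
      intro m0 m1 m2 m3 m4 m5 M e0 e1 e2 e3 e4 e5 h0 h1 h2 h3 h4 h5 hA'
      have a0 := neg_abs_le m0
      have a1 := neg_abs_le m1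
      have a2 := neg_abs_le m2
      have a3 := neg_abs_le m3
      have a4 := neg_abs_le m4
      have a5 := neg_abs_le m5
      have b0 := le_abs_self m0
      have b1 := le_abs_self m1
      have b2 := le_abs_self m2
      have b3 := le_abs_self m3
      have b4 := le_abs_self m4
      have b5 := le_abs_self m5
      fin_cases p
      · have e0 := e0 rfl
        have h1 := h1 (by decide)
        have h2 := h2 (by decide)
        have h3 := h3 (by decide)
        have h4 := h4 (by decide)
        have h5 := h5 (by decide)
        rcases abs_cases m0 with ⟨e, _⟩ | ⟨e, _⟩ <;> split_ifs <;>
          first | omega | (exfalso; linarith)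
      · have e1 := e1 rfl
        have hA' := hA' rfl
        have h0 := h0 (by decide)
        have h2 := h2 (by decide)
        have h3 := h3 (by decide)
        have h4 := h4 (by decide)
        have h5 := h5 (by decide)
        rcases abs_cases m1 with ⟨e, _⟩ | ⟨e, _⟩ <;> split_ifs <;>
          first | omega | (exfalso; linarith)
      · have e2 := e2 rfl
        have h0 := h0 (by decide)
        have h1 := h1 (by decide)
        have h3 := h3 (by decide)
        have h4 := h4 (by decide)
        have h5 := h5 (by decide)
        rcases abs_cases m2 with ⟨e, _⟩ | ⟨e, _⟩ <;> split_ifs <;>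
          first | omega | (exfalso; linarith)
      · have e3 := e3 rfl
        have h0 := h0 (by decide)
        have h1 := h1 (by decide)
        have h2 := h2 (by decide)
        have h4 := h4 (by decide)
        have h5 := h5 (by decide)
        rcases abs_cases m3 with ⟨e, _⟩ | ⟨e, _⟩ <;> split_ifs <;>
          first | omega | (exfalso; linarith)
      · have e4 := e4 rfl
        have h0 := h0 (by decide)
        have h1 := h1 (by decide)
        have h2 := h2 (by decide)
        have h3 := h3 (by decide)
        have h5 := h5 (by decide)
        rcases abs_cases m4 with ⟨e, _⟩ | ⟨e, _⟩ <;> split_ifs <;>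
          first | omega | (exfalso; linarith)
      · have e5 := e5 rfl
        have h0 := h0 (by decide)
        have h1 := h1 (by decide)
        have h2 := h2 (by decide)
        have h3 := h3 (by decide)
        have h4 := h4 (by decide)
        rcases abs_cases m5 with ⟨e, _⟩ | ⟨e, _⟩ <;> split_ifs <;>
          first | omega | (exfalso; linarith)
    have := key (c 0) (c 1 * t ^ 2) (c 2 * t ^ 3) (c 3 * t ^ 4) (c 4 * t ^ 5) (c 5 * t ^ 6)
      |c p * t ^ eexp p| (by rintro rfl; simp [eexp]) (by rintro rfl; simp [eexp])
      (by rintro rfl; simp [eexp]) (by rintro rfl; simp [eexp]) (by rintro rfl; simp [eexp])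
      (by rintro rfl; simp [eexp]) (by simpa [eexp] using h0) h1 h2 h3 h4 h5 hA'
    simp only [scount, tval, cflip, Fin.isValue, Matrix.cons_val]
    simp only [← neg_mul] at this
    exact this

lemma badPair_unique (c : Fin 6 → ℝ) (n : ℝ) (hn : 36 ≤ n) (p q : Fin 6) (hpq : p < q)
    (i i' : ℕ) (hi : badPair c (n ^ i) p q) (hi' : badPair c (n ^ i') p q) (hlt : i < i') :
    False := by
  have he := eexp_strictMono hpq
  obtain ⟨h1, -⟩ := hi
  obtain ⟨-, h2⟩ := hi'
  generalize eexp p = e at *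
  generalize eexp q = e' at *
  have hn0 : 0 < n := by linarith
  simp only [abs_mul, abs_of_pos (pow_pos (pow_pos hn0 _) _)] at h1 h2
  simp only [← pow_mul] at h1 h2
  have h3 : 0 ≤ |c p| := abs_nonneg _
  have h4 : 0 ≤ |c q| := abs_nonneg _
  have hmul : (|c p| * n ^ (i * e)) * (|c q| * n ^ (i' * e')) <
      (6 * (|c q| * n ^ (i * e'))) * (6 * (|c p| * n ^ (i' * e))) :=
    mul_lt_mul'' h1 h2 (by positivity) (by positivity)
  have hpw : 36 * (n ^ (i * e') * n ^ (i' * e)) ≤ n ^ (i * e) * n ^ (i' * e') := by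
    rw [← pow_add, ← pow_add]
    have hexp : (i * e' + i' * e) + 1 ≤ i * e + i' * e' := by
      obtain ⟨d, rfl⟩ := Nat.exists_eq_add_of_lt he
      obtain ⟨k, rfl⟩ := Nat.exists_eq_add_of_lt hlt
      nlinarith [Nat.zero_le (k * d), Nat.zero_le k, Nat.zero_le d]
    calc 36 * n ^ (i * e' + i' * e) ≤ n * n ^ (i * e' + i' * e) := by
            gcongr
      _ = n ^ (i * e' + i' * e + 1) := by ring
      _ ≤ _ := pow_le_pow_right₀ (by linarith) hexp
  nlinarith [mul_nonneg h3 h4, mul_le_mul_of_nonneg_left hpw (mul_nonneg h3 h4)]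

open Classical in
lemma scount_sum (c : Fin 6 → ℝ) (n : ℝ) (hn : 36 ≤ n) (K : ℕ) :
    ∑ i ∈ Finset.Icc 1 K, (scount c (n ^ i) + scount (cflip c) (n ^ i)) ≤
      2 * K + 30 + 2 * K * (if 0 < c 1 ∧ |c 2| ≤ c 1 then 1 else 0) := by
  have hs : ∀ (c : Fin 6 → ℝ) t, scount c t ≤ 2 := by
    intro c t
    unfold scount
    split_ifs <;> omega
  set PP : Finset (Fin 6 × Fin 6) := Finset.univ.filter fun x => x.1 < x.2 with hPP
  have hcard : PP.card = 15 := by rw [hPP]; decide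
  have hpt : ∀ i ∈ Finset.Icc 1 K, scount c (n ^ i) + scount (cflip c) (n ^ i) ≤
      2 + 2 * (if 0 < c 1 ∧ |c 2| ≤ c 1 then 1 else 0) +
        2 * ∑ x ∈ PP, if badPair c (n ^ i) x.1 x.2 then 1 else 0 := by
    intro i _
    have b1 := hs c (n ^ i)
    have b2 := hs (cflip c) (n ^ i)
    by_cases hg : ∀ p q, p < q → ¬ badPair c (n ^ i) p q
    · rcases scount_good c (n ^ i) (one_le_pow₀ (by linarith)) hg with h | h
      · omega
      · rw [if_pos h]; omega
    · push Not at hg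
      obtain ⟨p, q, hpq, hb⟩ := hg
      have : 1 ≤ ∑ x ∈ PP, if badPair c (n ^ i) x.1 x.2 then 1 else 0 := by
        have := Finset.single_le_sum (s := PP)
          (f := fun x => if badPair c (n ^ i) x.1 x.2 then 1 else 0)
          (fun _ _ => Nat.zero_le _) (a := (p, q)) (by simp [hPP, hpq])
        simpa [hb] using this
      omega
  refine (Finset.sum_le_sum hpt).trans ?_
  rw [Finset.sum_add_distrib, Finset.sum_const, ← Finset.mul_sum, Finset.sum_comm]
  have hb : ∑ x ∈ PP, ∑ i ∈ Finset.Icc 1 K, (if badPair c (n ^ i) x.1 x.2 then 1 else 0) ≤ 15 := by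
    rw [← hcard, Finset.card_eq_sum_ones]
    refine Finset.sum_le_sum fun x hx => ?_
    have hx' : x.1 < x.2 := by simpa [hPP] using hx
    rw [← Finset.card_filter, Finset.card_le_one]
    intro i hi j hj
    simp only [Finset.mem_filter] at hi hj
    rcases lt_trichotomy i j with h | h | h
    · exact (badPair_unique c n hn _ _ hx' i j hi.2 hj.2 h).elim
    · exact h
    · exact (badPair_unique c n hn _ _ hx' j i hj.2 hi.2 h).elim
  simp only [Nat.card_Icc, smul_eq_mul, Nat.add_sub_cancel]
  split_ifs <;> linarith

instance bernoulliBool_finite (p : ℝ) : IsFiniteMeasure (bernoulliBool p) := by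
  constructor
  simp [bernoulliBool]

lemma bernoulliBool_prob (p : ℝ) (h0 : 0 ≤ p) (h1 : p ≤ 1) :
    IsProbabilityMeasure (bernoulliBool p) := by
  constructor
  simp [bernoulliBool]
  rw [← ENNReal.ofReal_add h0 (by linarith)]
  simp

instance stdGaussianPi_prob (n : ℕ) : IsProbabilityMeasure (stdGaussianPi n) := by
  unfold stdGaussianPi; infer_instance

instance signUnif_sf : SFinite signUnif := by
  unfold signUnif; infer_instance

instance uniformFinset_sf {α : Type*} [MeasurableSpace α] (s : Finset α) :
    SFinite (uniformFinset s) := by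
  unfold uniformFinset
  have : IsFiniteMeasure (∑ a ∈ s, Measure.dirac a) := by
    constructor
    simp
  infer_instance

lemma prod_inner (K : ℕ) (T : Set (ℕ × ℝ)) (hT : MeasurableSet T) :
    ((uniformFinset (Finset.Icc 1 K)).prod signUnif) T =
      (K : ℝ≥0∞)⁻¹ * ∑ i ∈ Finset.Icc 1 K,
        2⁻¹ * (T.indicator 1 (i, 1) + T.indicator 1 (i, -1)) := by
  rw [Measure.prod_apply hT]
  unfold uniformFinset
  rw [lintegral_smul_measure, lintegral_finsetSum_measure]
  simp only [lintegral_dirac, Nat.card_Icc, Nat.add_sub_cancel, smul_eq_mul]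
  congr 1
  refine Finset.sum_congr rfl fun i _ => ?_
  have : MeasurableSet (Prod.mk i ⁻¹' T) := measurable_prodMk_left hT
  by_cases h1 : (i, (1 : ℝ)) ∈ T <;> by_cases h2 : (i, (-1 : ℝ)) ∈ T <;>
    simp [signUnif, this, h1, h2, mul_add]

lemma stdGaussianPi_neg (n : ℕ) (F : (Fin n → ℝ) → ℝ≥0∞) :
    ∫⁻ g, F (-g) ∂(stdGaussianPi n) = ∫⁻ g, F g ∂(stdGaussianPi n) := by
  have h : MeasurePreserving (fun x : ℝ => -x) (gaussianReal 0 1) (gaussianReal 0 1) := by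
    refine ⟨measurable_neg, ?_⟩
    have := gaussianReal_map_neg (μ := 0) (v := 1)
    simpa using this
  have h2 : MeasurePreserving (fun g : Fin n → ℝ => fun i => - g i)
      (stdGaussianPi n) (stdGaussianPi n) :=
    measurePreserving_pi _ _ (fun _ => h)
  exact h2.lintegral_comp_emb (MeasurableEquiv.neg (Fin n → ℝ)).measurableEmbedding F

lemma gaussian_le_volume (s : Set ℝ) : gaussianReal 0 1 s ≤ volume s := by
  rw [gaussianReal_apply _ (by norm_num)]
  calc ∫⁻ x in s, gaussianPDF 0 1 x ≤ ∫⁻ x in s, 1 := by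
        refine lintegral_mono fun x => ?_
        unfold gaussianPDF
        rw [ENNReal.ofReal_le_one]
        unfold gaussianPDFReal
        have h1 : rexp (-(x - 0) ^ 2 / (2 * ((1 : ℝ≥0) : ℝ))) ≤ 1 := by
          rw [Real.exp_le_one_iff]
          have := sq_nonneg (x - 0)
          simp only [NNReal.coe_one]
          linarith
        have h2 : (√(2 * π * ((1 : ℝ≥0) : ℝ)))⁻¹ ≤ 1 := by
          apply inv_le_one_of_one_le₀
          rw [Real.one_le_sqrt]
          have := Real.pi_gt_three
          simp only [NNReal.coe_one]
          linarith
        exact mul_le_one₀ h2 (Real.exp_nonneg _) h1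
    _ = volume s := by simp

/-- anti-concentration of a linear form of Gaussians -/
lemma gauss_small (n : ℕ) (w : Fin n → ℝ) (j : Fin n) (η s : ℝ) (hη : 0 < η) (hw : η < w j) :
    stdGaussianPi n {g | |∑ i, w i * g i| ≤ s} ≤ ENNReal.ofReal (2 * s / η) := by
  obtain ⟨m, rfl⟩ : ∃ m, n = m + 1 := ⟨n - 1, by have := j.pos; omega⟩
  have hmp := (measurePreserving_piFinSuccAbove (fun _ : Fin (m + 1) => gaussianReal 0 1) j).symm
  have hms : MeasurableSet {g : Fin (m + 1) → ℝ | |∑ i, w i * g i| ≤ s} :=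
    measurableSet_le (by fun_prop) (by fun_prop)
  unfold stdGaussianPi
  rw [← hmp.measure_preimage hms.nullMeasurableSet,
    Measure.prod_apply_symm (hmp.measurable hms)]
  have hwj : 0 < w j := hη.trans hw
  have : ∀ y : Fin m → ℝ, gaussianReal 0 1 ((fun x => (x, y)) ⁻¹'
      ((MeasurableEquiv.piFinSuccAbove (fun _ : Fin (m + 1) => ℝ) j).symm ⁻¹'
        {g : Fin (m + 1) → ℝ | |∑ i, w i * g i| ≤ s})) ≤ ENNReal.ofReal (2 * s / η) := by
    intro y
    refine (gaussian_le_volume _).trans ?_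
    set z := ∑ i, w (j.succAbove i) * y i with hz
    have hsub : ((fun x => (x, y)) ⁻¹'
      ((MeasurableEquiv.piFinSuccAbove (fun _ : Fin (m + 1) => ℝ) j).symm ⁻¹'
        {g : Fin (m + 1) → ℝ | |∑ i, w i * g i| ≤ s})) ⊆
        Set.Icc ((-s - z) / w j) ((s - z) / w j) := by
      intro x hx
      simp only [Set.mem_preimage, Set.mem_ofPred_eq] at hx
      rw [Fin.sum_univ_succAbove _ j] at hx
      simp [MeasurableEquiv.piFinSuccAbove, Fin.insertNthEquiv] at hx
      rw [← hz, abs_le] at hx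
      rw [Set.mem_Icc, div_le_iff₀ hwj, le_div_iff₀ hwj]
      constructor <;> nlinarith [hx.1, hx.2]
    refine (measure_mono hsub).trans ?_
    rw [Real.volume_Icc]
    rcases le_or_gt 0 s with hs | hs
    · apply ENNReal.ofReal_le_ofReal
      rw [← sub_div]
      have : s - z - (-s - z) = 2 * s := by ring
      rw [this]
      exact div_le_div_of_nonneg_left (by linarith) hη hw.le
    · rw [ENNReal.ofReal_of_nonpos]
      · simp
      · rw [← sub_div]
        exact div_nonpos_of_nonpos_of_nonneg (by linarith) hwj.le
  refine (lintegral_mono this).trans ?_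
  simp

lemma bern_false (n : ℕ) (p : ℝ) (h0 : 0 ≤ p) (h1 : p ≤ 1) (I : Finset (Fin n)) :
    (Measure.pi fun _ : Fin n => bernoulliBool p) {a | ∀ j ∈ I, a j = false} =
      ENNReal.ofReal (1 - p) ^ I.card := by
  have := bernoulliBool_prob p h0 h1
  have hset : {a : Fin n → Bool | ∀ j ∈ I, a j = false} =
      Set.pi Set.univ (fun j => if j ∈ I then {false} else Set.univ) := by
    ext a
    simp only [Set.mem_ofPred_eq, Set.mem_pi, Set.mem_univ, true_implies]
    refine forall_congr' fun j => ?_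
    by_cases hj : j ∈ I <;> simp [hj]
  rw [hset, Measure.pi_pi]
  have : ∀ j : Fin n, bernoulliBool p (if j ∈ I then {false} else Set.univ) =
      if j ∈ I then ENNReal.ofReal (1 - p) else 1 := by
    intro j
    split_ifs
    · simp [bernoulliBool]
    · exact measure_univ
  simp only [this]
  rw [Finset.prod_ite_mem]
  simp

/-- the masked Gaussian vector -/
noncomputable def rvec {n : ℕ} (a : Fin n → Bool) (g : Fin n → ℝ) : Fin n → ℝ :=
  fun j => if a j then g j else 0

noncomputable def coef {n : ℕ} (θ : ℝ) (cf : Fin n → ℝ) (c2 : Fin n → Fin n → ℝ)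
    (r : Fin n → ℝ) : Fin 6 → ℝ :=
  ![θ, (2 : ℝ) ^ (-(n : ℤ)) * ∑ i, cf i, ∑ i, cf i * r i,
    ((2 : ℝ) ^ (-(n : ℤ))) ^ 2 * ∑ i, ∑ j, (if i ≤ j then c2 i j else 0),
    (2 : ℝ) ^ (-(n : ℤ)) * ∑ i, ∑ j, (if i ≤ j then c2 i j else 0) * (r i + r j),
    ∑ i, ∑ j, (if i ≤ j then c2 i j else 0) * (r i * r j)]

noncomputable def quad {n : ℕ} (θ : ℝ) (cf : Fin n → ℝ) (c2 : Fin n → Fin n → ℝ)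
    (x : Fin n → ℝ) : ℝ :=
  θ + (∑ i, cf i * x i) + ∑ i, ∑ j, if i ≤ j then c2 i j * x i * x j else 0

lemma quad_eq {n : ℕ} (θ : ℝ) (cf : Fin n → ℝ) (c2 : Fin n → Fin n → ℝ)
    (a : Fin n → Bool) (g : Fin n → ℝ) (i : ℕ) (b : ℝ) (hb : b ^ 2 = 1) :
    quad θ cf c2 (T2Point n (a, g, i, b)) =
      tval (coef θ cf c2 (rvec a g)) ((n : ℝ) ^ i) b := by
  have hpt : T2Point n (a, g, i, b) = fun j => ((n : ℝ) ^ i) ^ 3 * rvec a g j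
      + b * ((n : ℝ) ^ i) ^ 2 * (2 : ℝ) ^ (-(n : ℤ)) := rfl
  rw [hpt]
  generalize rvec a g = r
  generalize (n : ℝ) ^ i = t
  simp only [quad, tval, coef, Matrix.cons_val, Fin.isValue]
  generalize (2 : ℝ) ^ (-(n : ℤ)) = d
  have h1 : ∑ i, cf i * (t ^ 3 * r i + b * t ^ 2 * d) =
      (∑ i, cf i * r i) * t ^ 3 + b * (d * (∑ i, cf i) * t ^ 2) := by
    simp only [Finset.mul_sum, Finset.sum_mul, ← Finset.sum_add_distrib]
    refine Finset.sum_congr rfl fun i _ => ?_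
    ring
  have h2 : (∑ i, ∑ j, if i ≤ j then c2 i j * (t ^ 3 * r i + b * t ^ 2 * d) *
      (t ^ 3 * r j + b * t ^ 2 * d) else 0) =
      d ^ 2 * (∑ i, ∑ j, (if i ≤ j then c2 i j else 0)) * t ^ 4 +
      (∑ i, ∑ j, (if i ≤ j then c2 i j else 0) * (r i * r j)) * t ^ 6 +
      b * (d * (∑ i, ∑ j, (if i ≤ j then c2 i j else 0) * (r i + r j)) * t ^ 5) := by
    simp only [Finset.mul_sum, Finset.sum_mul, ← Finset.sum_add_distrib]
    refine Finset.sum_congr rfl fun i _ => Finset.sum_congr rfl fun j _ => ?_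
    split_ifs
    · linear_combination (c2 i j * t ^ 4 * d ^ 2) * hb
    · ring
  rw [h1, h2]
  ring

lemma coef_neg {n : ℕ} (θ : ℝ) (cf : Fin n → ℝ) (c2 : Fin n → Fin n → ℝ)
    (a : Fin n → Bool) (g : Fin n → ℝ) :
    coef θ cf c2 (rvec a (-g)) = cflip (coef θ cf c2 (rvec a g)) := by
  have hr : ∀ j, rvec a (-g) j = - rvec a g j := by
    intro j
    unfold rvec
    split_ifs <;> simp
  have h1 : ∀ x y : ℝ, -x + -y = -(x + y) := by intros; ring
  simp only [coef, cflip, hr, Matrix.cons_val, Fin.isValue, mul_neg, neg_mul, neg_neg,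
    Finset.sum_neg_distrib, h1]

lemma sign_eq_one_iff' (x : ℝ) : Real.sign x = 1 ↔ 0 < x := by
  rcases lt_trichotomy x 0 with h | h | h
  · rw [Real.sign_of_neg h]; constructor <;> intro h' <;> linarith
  · subst h; simp
  · rw [Real.sign_of_pos h]; simp [h]

lemma sign_eq_neg_one_iff' (x : ℝ) : Real.sign x = -1 ↔ x < 0 := by
  rcases lt_trichotomy x 0 with h | h | h
  · rw [Real.sign_of_neg h]; simp [h]
  · subst h; simp
  · rw [Real.sign_of_pos h]; constructor <;> intro h' <;> linarith

lemma measurable_sign' : Measurable Real.sign := by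
  unfold Real.sign
  exact Measurable.ite measurableSet_Iio measurable_const
    (Measurable.ite measurableSet_Ioi measurable_const measurable_const)

def passSet {n : ℕ} (θ : ℝ) (cf : Fin n → ℝ) (c2 : Fin n → Fin n → ℝ) :
    Set ((Fin n → Bool) × (Fin n → ℝ) × ℕ × ℝ) :=
  {ω | Real.sign (quad θ cf c2 (T2Point n ω)) = ω.2.2.2}

lemma measurable_T2Point (n : ℕ) : Measurable (T2Point n) := by
  rw [measurable_pi_iff]
  intro j
  unfold T2Point
  have h1 : Measurable fun ω : (Fin n → Bool) × (Fin n → ℝ) × ℕ × ℝ => (n : ℝ) ^ ω.2.2.1 :=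
    (measurable_from_nat (f := fun k : ℕ => (n : ℝ) ^ k)).comp (by fun_prop)
  have h2 : Measurable fun ω : (Fin n → Bool) × (Fin n → ℝ) × ℕ × ℝ =>
      (if ω.1 j then ω.2.1 j else 0 : ℝ) := by
    refine Measurable.ite ?_ (by fun_prop) measurable_const
    have : Measurable fun ω : (Fin n → Bool) × (Fin n → ℝ) × ℕ × ℝ => ω.1 j := by fun_prop
    exact this (measurableSet_singleton true)
  fun_prop

lemma measurable_quad {n : ℕ} (θ : ℝ) (cf : Fin n → ℝ) (c2 : Fin n → Fin n → ℝ) :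
    Measurable (quad θ cf c2) := by
  unfold quad
  refine (measurable_const.add (by fun_prop)).add ?_
  refine Finset.measurable_sum _ fun i _ => Finset.measurable_sum _ fun j _ => ?_
  split_ifs <;> fun_prop

lemma measurableSet_passSet {n : ℕ} (θ : ℝ) (cf : Fin n → ℝ) (c2 : Fin n → Fin n → ℝ) :
    MeasurableSet (passSet θ cf c2) :=
  measurableSet_eq_fun
    (measurable_sign'.comp ((measurable_quad θ cf c2).comp (measurable_T2Point n)))
    (by fun_prop)

/-- the set of masks and Gaussians where the linear form is tiny -/
def smallSet {n : ℕ} (cf : Fin n → ℝ) : Set ((Fin n → Bool) × (Fin n → ℝ)) :=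
  {x | 0 < ∑ i, cf i ∧ |∑ i, cf i * rvec x.1 x.2 i| ≤ (2 : ℝ) ^ (-(n : ℤ)) * ∑ i, cf i}

lemma measurableSet_smallSet {n : ℕ} (cf : Fin n → ℝ) : MeasurableSet (smallSet cf) := by
  unfold smallSet
  rw [Set.ofPred_and]
  refine (MeasurableSet.const _).inter (measurableSet_le ?_ measurable_const)
  refine Measurable.abs (Finset.measurable_sum _ fun i _ => measurable_const.mul ?_)
  unfold rvec
  refine Measurable.ite ?_ (by fun_prop) measurable_const
  have : Measurable fun ω : (Fin n → Bool) × (Fin n → ℝ) => ω.1 i := by fun_prop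
  exact this (measurableSet_singleton true)

/-- conditional pass probability -/
noncomputable def condPass {n : ℕ} (K : ℕ) (θ : ℝ) (cf : Fin n → ℝ) (c2 : Fin n → Fin n → ℝ)
    (a : Fin n → Bool) (g : Fin n → ℝ) : ℝ≥0∞ :=
  (K : ℝ≥0∞)⁻¹ * ∑ i ∈ Finset.Icc 1 K,
    2⁻¹ * (scount (coef θ cf c2 (rvec a g)) ((n : ℝ) ^ i) : ℝ≥0∞)

lemma T2_eq {n : ℕ} (θ : ℝ) (cf : Fin n → ℝ) (c2 : Fin n → Fin n → ℝ) :
    T2Measure n (passSet θ cf c2) =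
      ∫⁻ a, ∫⁻ g, condPass ⌊(Real.log n) ^ 2⌋₊ θ cf c2 a g ∂(stdGaussianPi n)
        ∂(Measure.pi fun _ : Fin n => bernoulliBool (1 / Real.log n)) := by
  have hS := measurableSet_passSet θ cf c2
  unfold T2Measure
  rw [Measure.prod_apply hS]
  refine lintegral_congr fun a => ?_
  have hS1 : MeasurableSet (Prod.mk a ⁻¹' passSet θ cf c2) := measurable_prodMk_left hS
  rw [Measure.prod_apply hS1]
  refine lintegral_congr fun g => ?_
  rw [prod_inner _ _ (measurable_prodMk_left hS1)]
  classical
  unfold condPass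
  congr 1
  refine Finset.sum_congr rfl fun i _ => ?_
  congr 1
  unfold scount
  push_cast
  have e1 : (i, (1 : ℝ)) ∈ (Prod.mk g ⁻¹' (Prod.mk a ⁻¹' passSet θ cf c2)) ↔
      0 < tval (coef θ cf c2 (rvec a g)) ((n : ℝ) ^ i) 1 := by
    rw [← quad_eq _ _ _ _ _ _ _ (by norm_num), ← sign_eq_one_iff']
    rfl
  have e2 : (i, (-1 : ℝ)) ∈ (Prod.mk g ⁻¹' (Prod.mk a ⁻¹' passSet θ cf c2)) ↔
      tval (coef θ cf c2 (rvec a g)) ((n : ℝ) ^ i) (-1) < 0 := by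
    rw [← quad_eq _ _ _ _ _ _ _ (by norm_num), ← sign_eq_neg_one_iff']
    rfl
  rw [Set.indicator_apply, Set.indicator_apply]
  simp only [e1, e2, Pi.one_apply]

lemma condPass_sum {n : ℕ} (hn : 36 ≤ n) (K : ℕ) (hK : 1 ≤ K) (θ : ℝ) (cf : Fin n → ℝ)
    (c2 : Fin n → Fin n → ℝ) (a : Fin n → Bool) (g : Fin n → ℝ) :
    condPass K θ cf c2 a g + condPass K θ cf c2 a (-g) ≤
      1 + 15 * (K : ℝ≥0∞)⁻¹ + (smallSet cf).indicator 1 (a, g) := by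
  classical
  have h := scount_sum (coef θ cf c2 (rvec a g)) n (by exact_mod_cast hn) K
  unfold condPass
  rw [coef_neg, ← mul_add, ← Finset.sum_add_distrib]
  simp only [← mul_add]
  rw [← Finset.mul_sum]
  have hK0 : (K : ℝ≥0∞) ≠ 0 := by
    simp; omega
  have hKt : (K : ℝ≥0∞) ≠ ⊤ := ENNReal.natCast_ne_top K
  have hcoef : (if 0 < (coef θ cf c2 (rvec a g)) 1 ∧
      |(coef θ cf c2 (rvec a g)) 2| ≤ (coef θ cf c2 (rvec a g)) 1 then 1 else 0 : ℕ) =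
      if (a, g) ∈ smallSet cf then 1 else 0 := by
    have : (0 < (coef θ cf c2 (rvec a g)) 1 ∧
      |(coef θ cf c2 (rvec a g)) 2| ≤ (coef θ cf c2 (rvec a g)) 1) ↔ (a, g) ∈ smallSet cf := by
      have hd : (0 : ℝ) < (2 : ℝ) ^ (-(n : ℤ)) := by positivity
      simp only [coef, Matrix.cons_val, Fin.isValue, smallSet, Set.mem_ofPred_eq]
      rw [mul_pos_iff_of_pos_left hd]
    simp only [this]
  rw [hcoef] at h
  have h' : ∑ i ∈ Finset.Icc 1 K, ((scount (coef θ cf c2 (rvec a g)) ((n : ℝ) ^ i) : ℝ≥0∞) +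
      (scount (cflip (coef θ cf c2 (rvec a g))) ((n : ℝ) ^ i) : ℝ≥0∞)) ≤
      2 * (K : ℝ≥0∞) + 30 + 2 * K * (smallSet cf).indicator 1 (a, g) := by
    have h2 : ((∑ i ∈ Finset.Icc 1 K, (scount (coef θ cf c2 (rvec a g)) ((n : ℝ) ^ i) +
      scount (cflip (coef θ cf c2 (rvec a g))) ((n : ℝ) ^ i)) : ℕ) : ℝ≥0∞) ≤
      ((2 * K + 30 + 2 * K * (if (a, g) ∈ smallSet cf then 1 else 0) : ℕ) : ℝ≥0∞) :=
      Nat.cast_le.2 h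
    push_cast at h2
    rw [Set.indicator_apply]
    exact h2
  calc _ ≤ (K : ℝ≥0∞)⁻¹ * (2⁻¹ * (2 * (K : ℝ≥0∞) + 30 +
        2 * K * (smallSet cf).indicator 1 (a, g))) := by gcongr
    _ = _ := by
      have e : (K : ℝ≥0∞)⁻¹ * (2⁻¹ * (2 * (K : ℝ≥0∞) + 30 +
        2 * K * (smallSet cf).indicator 1 (a, g))) =
        ((K : ℝ≥0∞)⁻¹ * K) * (2⁻¹ * 2) + (2⁻¹ * 2) * 15 * (K : ℝ≥0∞)⁻¹ +
        ((K : ℝ≥0∞)⁻¹ * K) * (2⁻¹ * 2) * (smallSet cf).indicator 1 (a, g) := by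
        ring
      rw [e, ENNReal.inv_mul_cancel hK0 hKt, ENNReal.inv_mul_cancel (by norm_num) (by norm_num)]
      ring

lemma T2_le {n : ℕ} (hn : 36 ≤ n) (hK : 1 ≤ ⌊(Real.log n) ^ 2⌋₊) (hL : 1 ≤ Real.log n)
    (θ : ℝ) (cf : Fin n → ℝ) (c2 : Fin n → Fin n → ℝ) :
    2 * T2Measure n (passSet θ cf c2) ≤ 1 + 15 * (⌊(Real.log n) ^ 2⌋₊ : ℝ≥0∞)⁻¹ +
      ((Measure.pi fun _ : Fin n => bernoulliBool (1 / Real.log n)).prod (stdGaussianPi n))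
        (smallSet cf) := by
  have hp := bernoulliBool_prob (1 / Real.log n) (by positivity)
    (by rw [div_le_one (by linarith)]; exact hL)
  rw [T2_eq]
  set K := ⌊(Real.log n) ^ 2⌋₊
  set μ := (Measure.pi fun _ : Fin n => bernoulliBool (1 / Real.log n))
  have hm : ∀ a, Measurable fun g => condPass K θ cf c2 a g := by
    intro a
    unfold condPass
    refine Measurable.const_mul (Finset.measurable_sum _ fun i _ => Measurable.const_mul ?_ _) _
    have hr : Measurable (rvec a) := by
      rw [measurable_pi_iff]
      intro j
      unfold rvec
      split_ifs <;> fun_prop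
    have ht : ∀ b, Measurable fun g => tval (coef θ cf c2 (rvec a g)) ((n : ℝ) ^ i) b := by
      intro b
      simp only [tval, coef, Matrix.cons_val, Fin.isValue]
      fun_prop
    have : Measurable fun g => scount (coef θ cf c2 (rvec a g)) ((n : ℝ) ^ i) := by
      unfold scount
      refine Measurable.add ?_ ?_
      · exact Measurable.ite (measurableSet_lt measurable_const (ht 1)) measurable_const
          measurable_const
      · exact Measurable.ite (measurableSet_lt (ht (-1)) measurable_const) measurable_const
          measurable_const
    exact (measurable_from_nat (f := fun k : ℕ => (k : ℝ≥0∞))).comp this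
  rw [← lintegral_const_mul' _ _ (by norm_num)]
  have hstep : ∀ a, 2 * ∫⁻ g, condPass K θ cf c2 a g ∂(stdGaussianPi n) ≤
      1 + 15 * (K : ℝ≥0∞)⁻¹ + stdGaussianPi n (Prod.mk a ⁻¹' smallSet cf) := by
    intro a
    rw [two_mul]
    nth_rewrite 2 [← stdGaussianPi_neg]
    rw [← lintegral_add_left (hm a)]
    refine (lintegral_mono fun g => condPass_sum hn K hK θ cf c2 a g).trans ?_
    rw [lintegral_add_left measurable_const]
    refine add_le_add (by simp) ?_
    rw [← lintegral_indicator_one (measurable_prodMk_left (measurableSet_smallSet cf))]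
    rfl
  refine (lintegral_mono hstep).trans ?_
  rw [lintegral_add_left measurable_const, Measure.prod_apply (measurableSet_smallSet cf)]
  simp

lemma small_le {n : ℕ} (hn : 1 ≤ n) (p : ℝ) (h0 : 0 ≤ p) (h1 : p ≤ 1) (cf : Fin n → ℝ) :
    ((Measure.pi fun _ : Fin n => bernoulliBool p).prod (stdGaussianPi n)) (smallSet cf) ≤
      ENNReal.ofReal (1 - p) ^
        (Finset.univ.filter fun i : Fin n => (∑ j, cf j) / (n : ℝ) ^ 2 < cf i).card +
      ENNReal.ofReal (2 * (n : ℝ) ^ 2 * (2 : ℝ) ^ (-(n : ℤ))) := by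
  have hp := bernoulliBool_prob p h0 h1
  set I := Finset.univ.filter fun i : Fin n => (∑ j, cf j) / (n : ℝ) ^ 2 < cf i with hI
  rw [Measure.prod_apply (measurableSet_smallSet cf)]
  set F : Set (Fin n → Bool) := {a | ∀ j ∈ I, a j = false} with hF
  have hFm : MeasurableSet F := (Set.toFinite F).measurableSet
  rw [← bern_false n p h0 h1 I, ← hF, ← lintegral_indicator_one hFm]
  have hpt : ∀ a : Fin n → Bool, stdGaussianPi n (Prod.mk a ⁻¹' smallSet cf) ≤
      F.indicator 1 a + ENNReal.ofReal (2 * (n : ℝ) ^ 2 * (2 : ℝ) ^ (-(n : ℤ))) := by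
    intro a
    by_cases ha : a ∈ F
    · rw [Set.indicator_of_mem ha]
      exact le_add_right prob_le_one
    · by_cases hA : 0 < ∑ i, cf i
      · have : ∃ j ∈ I, a j = true := by
          by_contra hcon
          push Not at hcon
          exact ha fun j hj => by simpa using hcon j hj
        obtain ⟨j, hj, haj⟩ := this
        have hj' : (∑ j, cf j) / (n : ℝ) ^ 2 < cf j := by simpa [hI] using hj
        have hn0 : (0 : ℝ) < n := by exact_mod_cast hn
        have := gauss_small n (fun i => if a i then cf i else 0) j ((∑ j, cf j) / (n : ℝ) ^ 2)
          ((2 : ℝ) ^ (-(n : ℤ)) * ∑ i, cf i) (by positivity) (by simpa [haj] using hj')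
        refine le_add_left ?_
        have heq : 2 * ((2 : ℝ) ^ (-(n : ℤ)) * ∑ i, cf i) / ((∑ j, cf j) / (n : ℝ) ^ 2) =
            2 * (n : ℝ) ^ 2 * (2 : ℝ) ^ (-(n : ℤ)) := by
          have hA' := hA.ne'
          field_simp
        rw [heq] at this
        refine (measure_mono ?_).trans this
        intro g hg
        have hg2 : |∑ i, cf i * rvec a g i| ≤ (2 : ℝ) ^ (-(n : ℤ)) * ∑ i, cf i := hg.2
        have hs : ∑ i, (if a i then cf i else 0) * g i = ∑ i, cf i * rvec a g i := by
          refine Finset.sum_congr rfl fun i _ => ?_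
          unfold rvec
          split_ifs <;> simp
        show |∑ i, (if a i then cf i else 0) * g i| ≤ _
        rw [hs]
        exact hg2
      · have : Prod.mk a ⁻¹' smallSet cf = ∅ := by
          ext g
          simp only [Set.mem_preimage, Set.mem_empty_iff_false, iff_false]
          exact fun h => hA h.1
        rw [this]
        simp
  refine (lintegral_mono hpt).trans ?_
  rw [lintegral_add_right _ measurable_const]
  simp

lemma smallSet_null {n : ℕ} (μ : Measure ((Fin n → Bool) × (Fin n → ℝ))) (cf : Fin n → ℝ)
    (h : ¬ 0 < ∑ i, cf i) : μ (smallSet cf) = 0 := by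
  have : smallSet cf = ∅ := by
    ext g
    simp only [Set.mem_empty_iff_false, iff_false]
    exact fun h' => h h'.1
  rw [this]
  simp

open Filter Topology in
lemma numeric_s14 : ∃ N : ℕ, ∀ n ≥ N, 36 ≤ n ∧ 1 ≤ ⌊(Real.log n) ^ 2⌋₊ ∧ 1 ≤ Real.log n ∧
    15 / (⌊(Real.log n) ^ 2⌋₊ : ℝ) < 1 / Real.log n ∧
    1 / (n : ℝ) + 2 * (n : ℝ) ^ 2 * (2 : ℝ) ^ (-(n : ℤ)) < 1 / Real.log n := by
  have hlog : Tendsto (fun n : ℕ => Real.log n) atTop atTop :=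
    Real.tendsto_log_atTop.comp tendsto_natCast_atTop_atTop
  have h3 : Tendsto (fun n : ℕ => (n : ℝ) ^ 3 * (1 / 2 : ℝ) ^ n) atTop (𝓝 0) :=
    tendsto_pow_const_mul_const_pow_of_abs_lt_one 3 (by norm_num [abs_of_pos])
  have h4 : Tendsto (fun n : ℕ => Real.log n / n) atTop (𝓝 0) := by
    have := (Real.isLittleO_log_id_atTop.tendsto_div_nhds_zero).comp
      (tendsto_natCast_atTop_atTop (R := ℝ))
    exact this
  have hev := ((eventually_ge_atTop 36).and ((hlog.eventually_ge_atTop 20).and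
    ((h3.eventually (gt_mem_nhds (by norm_num : (0 : ℝ) < 1 / 4))).and
      (h4.eventually (gt_mem_nhds (by norm_num : (0 : ℝ) < 1 / 2))))))
  obtain ⟨N, hN⟩ := eventually_atTop.1 hev
  refine ⟨N, fun n hn => ?_⟩
  obtain ⟨a1, a2, a3, a4⟩ := hN n hn
  have hn0 : (0 : ℝ) < n := by
    have : (36 : ℝ) ≤ n := by exact_mod_cast a1
    linarith
  set l := Real.log n
  have hl : 0 < l := by linarith
  have hfl : l ^ 2 - 1 < ⌊l ^ 2⌋₊ := Nat.sub_one_lt_floor _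
  have hK : 15 * l < (⌊l ^ 2⌋₊ : ℝ) := by nlinarith
  have hK0 : (0 : ℝ) < ⌊l ^ 2⌋₊ := by nlinarith
  refine ⟨a1, ?_, by linarith, ?_, ?_⟩
  · exact_mod_cast hK0
  · rw [div_lt_div_iff₀ hK0 hl]
    linarith
  · rw [lt_div_iff₀ hl]
    have hln : l ≤ n := Real.log_le_self hn0.le
    have hz : (2 : ℝ) ^ (-(n : ℤ)) = (1 / 2 : ℝ) ^ n := by
      rw [zpow_neg, zpow_natCast, one_div, inv_pow]
    rw [hz, add_mul]
    have e1 : 1 / (n : ℝ) * l = l / n := by ring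
    have e2 : 2 * (n : ℝ) ^ 2 * (1 / 2 : ℝ) ^ n * l ≤ 2 * ((n : ℝ) ^ 3 * (1 / 2 : ℝ) ^ n) := by
      have : 0 ≤ 2 * (n : ℝ) ^ 2 * (1 / 2 : ℝ) ^ n := by positivity
      calc _ ≤ 2 * (n : ℝ) ^ 2 * (1 / 2 : ℝ) ^ n * n := mul_le_mul_of_nonneg_left hln this
        _ = _ := by ring
    rw [e1]
    linarith

/-- Soundness of the dictator test `T₂` (Lemma 5.2): for sufficiently large
`n`, if a degree-2 polynomial
`f(x) = θ + Σᵢ cᵢ xᵢ + Σ_{i ≤ j} c_{ij} xᵢ xⱼ` passes `T₂` with probability at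
least `1/2 + β` (`β = 1/log n`), then with `A = Σᵢ cᵢ` and
`I(f) = {i : cᵢ > A/n²}` one has `|I(f)| ≤ 1/β²` and `A > 0`. -/
theorem stmt14 :
    ∃ N : ℕ, ∀ n ≥ N, ∀ (θ : ℝ) (cf : Fin n → ℝ) (c2 : Fin n → Fin n → ℝ),
      ENNReal.ofReal (1 / 2 + 1 / Real.log n) ≤
        T2Measure n {ω | Real.sign
          ((fun x : Fin n → ℝ => θ + (∑ i, cf i * x i) +
            ∑ i, ∑ j, if i ≤ j then c2 i j * x i * x j else 0) (T2Point n ω)) = ω.2.2.2} →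
      ((Finset.univ.filter fun i : Fin n => (∑ j, cf j) / (n : ℝ) ^ 2 < cf i).card : ℝ) ≤
          1 / (1 / Real.log n) ^ 2 ∧
        0 < ∑ i, cf i := by
  obtain ⟨N, hN⟩ := numeric_s14
  refine ⟨N, fun n hn θ cf c2 hpass => ?_⟩
  obtain ⟨h36, hK, hL, hnum1, hnum2⟩ := hN n hn
  have hpass' : ENNReal.ofReal (1 / 2 + 1 / Real.log n) ≤ T2Measure n (passSet θ cf c2) := hpass
  have hle := T2_le h36 hK hL θ cf c2
  have hl0 : 0 < Real.log n := by linarith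
  have hp0 : 0 ≤ 1 / Real.log n := by positivity
  have hp1 : 1 / Real.log n ≤ 1 := by
    rw [div_le_one hl0]; exact hL
  set K := ⌊(Real.log n) ^ 2⌋₊ with hKdef
  have hK0 : (0 : ℝ) < K := by exact_mod_cast hK
  set M := ((Measure.pi fun _ : Fin n => bernoulliBool (1 / Real.log n)).prod (stdGaussianPi n))
        (smallSet cf) with hM
  have hKe : 15 * (K : ℝ≥0∞)⁻¹ = ENNReal.ofReal (15 / K) := by
    rw [ENNReal.ofReal_div_of_pos hK0, ENNReal.ofReal_natCast]
    norm_num [div_eq_mul_inv]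
  have hbig : ENNReal.ofReal (1 + 2 * (1 / Real.log n)) ≤ 1 + ENNReal.ofReal (15 / K) + M := by
    rw [← hKe]
    refine le_trans ?_ hle
    refine le_trans (le_of_eq ?_) (mul_le_mul_right hpass' 2)
    rw [show (2 : ℝ≥0∞) = ENNReal.ofReal 2 by norm_num, ← ENNReal.ofReal_mul (by norm_num)]
    congr 1
    ring
  have contra : ∀ x : ℝ, 0 ≤ x → x < 1 / Real.log n → M ≤ ENNReal.ofReal x → False := by
    intro x hx0 hx hMx
    have h15 : (0 : ℝ) ≤ 15 / K := by positivity
    have h := hbig.trans (add_le_add_right hMx _)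
    rw [← ENNReal.ofReal_one, ← ENNReal.ofReal_add (by norm_num) h15,
      ← ENNReal.ofReal_add (by linarith) hx0,
      ENNReal.ofReal_le_ofReal_iff (by linarith)] at h
    linarith
  constructor
  · by_contra hcon
    push Not at hcon
    have hn0 : (0 : ℝ) < n := by
      have : (36 : ℝ) ≤ n := by exact_mod_cast h36
      linarith
    have hsm := small_le (by omega : 1 ≤ n) _ hp0 hp1 cf
    rw [← hM] at hsm
    set m := (Finset.univ.filter fun i : Fin n => (∑ j, cf j) / (n : ℝ) ^ 2 < cf i).card
    have hpow : (1 - 1 / Real.log n) ^ m ≤ 1 / (n : ℝ) := by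
      have e1 : 1 - 1 / Real.log n ≤ Real.exp (-(1 / Real.log n)) := by
        have := Real.add_one_le_exp (-(1 / Real.log n))
        linarith
      calc (1 - 1 / Real.log n) ^ m ≤ (Real.exp (-(1 / Real.log n))) ^ m :=
            pow_le_pow_left₀ (by linarith) e1 m
        _ = Real.exp (-(m / Real.log n)) := by
            rw [← Real.exp_nat_mul]; congr 1; ring
        _ ≤ Real.exp (-Real.log n) := by
            rw [Real.exp_le_exp, neg_le_neg_iff, le_div_iff₀ hl0]
            have : 1 / (1 / Real.log n) ^ 2 = Real.log n * Real.log n := by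
              field_simp
            linarith
        _ = 1 / (n : ℝ) := by rw [Real.exp_neg, Real.exp_log hn0, one_div]
    refine contra _ (by positivity) hnum2 (hsm.trans ?_)
    rw [ENNReal.ofReal_add (by positivity) (by positivity), ← ENNReal.ofReal_pow (by linarith)]
    exact add_le_add_left (ENNReal.ofReal_le_ofReal hpow) _
  · by_contra hcon
    refine contra 0 le_rfl (by positivity) ?_
    rw [hM, smallSet_null _ _ hcon]
    simp
end
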